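/- Let G be a locally compact topological group. The set of values of p ∈ (0,∞) such that G admits a metrically proper continuous affine isometric action on an L_p space is upward closed: if 0 < p < q < ∞ and G admits a metrically proper continuous affine isometric action on some L_p space, then G admits a metrically proper continuous affine isometric action on some L_q space. -/

import Mathlib

open MeasureTheory ENNReal

/-- The quantity `‖f‖_p^p = ∫ |f|^p dμ`, valued in `ℝ≥0∞`.  This is the natural way to
measure the size of an element of an `L_p` space for any `0 < p < ∞`. -/
noncomputable def pPow {X : Type*} [MeasurableSpace X] (μ : Measure X) (p : ℝ)
    (f : X →ₘ[μ] ℂ) : ℝ≥0∞ :=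
  ∫⁻ x, (‖f x‖₊ : ℝ≥0∞) ^ p ∂μ

/-- A continuous affine isometric action of a topological group `G` on `L_p(X,μ)`:
a group homomorphism from `G` to the group of surjective affine isometries of
`L_p(X,μ)`, such that `g ↦ α_g f` is continuous for every `f`.  (Surjectivity of each
`act g` is automatic from the group laws.)  Isometry is expressed via the quantity
`pPow μ p` (i.e. `‖·‖_p^p`), and continuity via convergence in `L_p`, which makes sense
for every `0 < p < ∞`, including `p < 1`. -/
structure AffineIsometricAction (G : Type*) [Group G] [TopologicalSpace G]
    {X : Type*} [MeasurableSpace X] (μ : Measure X) (p : ℝ) where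
  act : G → Lp ℂ (ENNReal.ofReal p) μ → Lp ℂ (ENNReal.ofReal p) μ
  act_one : ∀ f, act 1 f = f
  act_mul : ∀ g h f, act (g * h) f = act g (act h f)
  isometry : ∀ g f f',
    pPow μ p ((act g f : X →ₘ[μ] ℂ) - (act g f' : X →ₘ[μ] ℂ))
      = pPow μ p ((f : X →ₘ[μ] ℂ) - (f' : X →ₘ[μ] ℂ))
  affine : ∀ (g : G) (t : ℝ) (f f' : Lp ℂ (ENNReal.ofReal p) μ),
    act g (t • f + (1 - t) • f') = t • act g f + (1 - t) • act g f'
  continuous : ∀ (f : Lp ℂ (ENNReal.ofReal p) μ) (g₀ : G),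
    Filter.Tendsto (fun g => pPow μ p ((act g f : X →ₘ[μ] ℂ) - (act g₀ f : X →ₘ[μ] ℂ)))
      (nhds g₀) (nhds 0)

/-- An affine isometric action of `G` on `L_p(X,μ)` is *metrically proper* if for every
finite `R`, the set `{g : ‖α_g(0)‖_p^p ≤ R}` is relatively compact in `G`. -/
def AffineIsometricAction.MetricallyProper {G : Type*} [Group G] [TopologicalSpace G]
    {X : Type*} [MeasurableSpace X] {μ : Measure X} {p : ℝ}
    (α : AffineIsometricAction G μ p) : Prop :=
  ∀ R : ℝ≥0∞, R ≠ ⊤ →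
    IsCompact (closure {g : G | pPow μ p ((α.act g 0 : X →ₘ[μ] ℂ)) ≤ R})


set_option linter.all false

section basic
open Filter Topology

variable {Y : Type*} [MeasurableSpace Y]

/-- The integral of the `q`-th power of the norm. -/
noncomputable def pInt {E : Type*} [NormedAddCommGroup E] (ν : Measure Y) (q : ℝ) (F : Y → E) :
    ℝ≥0∞ := ∫⁻ y, ‖F y‖ₑ ^ q ∂ν

lemma enorm_add_rpow_le {E : Type*} [NormedAddCommGroup E] {q : ℝ} (hq : 0 < q) (a b : E) :
    ‖a + b‖ₑ ^ q ≤ 2 ^ q * (‖a‖ₑ ^ q + ‖b‖ₑ ^ q) := by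
  have h1 : ‖a + b‖ₑ ≤ 2 * max ‖a‖ₑ ‖b‖ₑ := by
    refine (enorm_add_le a b).trans ?_
    rw [two_mul]
    exact add_le_add (le_max_left _ _) (le_max_right _ _)
  calc ‖a + b‖ₑ ^ q ≤ (2 * max ‖a‖ₑ ‖b‖ₑ) ^ q := ENNReal.rpow_le_rpow h1 hq.le
    _ = 2 ^ q * (max ‖a‖ₑ ‖b‖ₑ) ^ q := ENNReal.mul_rpow_of_nonneg _ _ hq.le
    _ ≤ _ := by
      gcongr
      rcases le_total ‖a‖ₑ ‖b‖ₑ with h | h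
      · rw [max_eq_right h]; exact le_add_self
      · rw [max_eq_left h]; exact le_self_add

lemma two_rpow_ne_top (q : ℝ) : (2 : ℝ≥0∞) ^ q ≠ ⊤ := by
  simp [ENNReal.rpow_eq_top_iff]

section
variable {E : Type*} [NormedAddCommGroup E] [MeasurableSpace E] [BorelSpace E]
variable {ν : Measure Y} {q : ℝ}

lemma pInt_add_le (hq : 0 < q) {F H : Y → E} (hF : AEMeasurable F ν) :
    pInt ν q (fun y => F y + H y) ≤ 2 ^ q * (pInt ν q F + pInt ν q H) := by
  unfold pInt
  rw [← lintegral_add_left' (by fun_prop), ← lintegral_const_mul' _ _ (two_rpow_ne_top q)]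
  exact lintegral_mono fun y => enorm_add_rpow_le hq _ _

lemma pInt_congr {E' : Type*} [NormedAddCommGroup E'] {F : Y → E} {H : Y → E'}
    (h : ∀ᵐ y ∂ν, ‖F y‖ₑ = ‖H y‖ₑ) : pInt ν q F = pInt ν q H :=
  lintegral_congr_ae (h.mono fun y hy => by simp only [hy])

lemma pInt_mono {E' : Type*} [NormedAddCommGroup E'] (hq : 0 < q) {F : Y → E} {H : Y → E'}
    (h : ∀ᵐ y ∂ν, ‖F y‖ₑ ≤ ‖H y‖ₑ) : pInt ν q F ≤ pInt ν q H :=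
  lintegral_mono_ae (h.mono fun y hy => ENNReal.rpow_le_rpow hy hq.le)

lemma memLp_iff_pInt (hq : 0 < q) {F : Y → E} (hF : AEStronglyMeasurable F ν) :
    MemLp F (ENNReal.ofReal q) ν ↔ pInt ν q F < ⊤ := by
  have h1 : ENNReal.ofReal q ≠ 0 := by simpa using hq
  unfold MemLp pInt
  rw [eLpNorm_lt_top_iff_lintegral_rpow_enorm_lt_top h1 (by simp), ENNReal.toReal_ofReal hq.le]
  simp [hF]

lemma pInt_smul (hq : 0 < q) [NormedSpace ℝ E] (t : ℝ) (F : Y → E) :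
    pInt ν q (fun y => t • F y) = ‖t‖ₑ ^ q * pInt ν q F := by
  unfold pInt
  rw [← lintegral_const_mul' _ _ (by simp [hq.le])]
  refine lintegral_congr fun y => ?_
  rw [enorm_smul, ENNReal.mul_rpow_of_nonneg _ _ hq.le]

lemma pPow_eq_pInt (f : Y →ₘ[ν] ℂ) : pPow ν q f = pInt ν q (f : Y → ℂ) := rfl

end

/-- Data of a cocycle for a nonsingular action. -/
structure NSData (G : Type*) [Group G] [TopologicalSpace G] (ν : Measure Y) (q : ℝ) where
  S : G → Y → Y
  w : G → Y → ℝ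
  b : G → Y → ℝ
  hS : ∀ g, Measurable (S g)
  hw : ∀ g, Measurable (w g)
  hb : ∀ g, Measurable (b g)
  hw0 : ∀ g y, 0 < w g y
  hmap : ∀ g, ∀ F : Y → ℝ≥0∞, Measurable F →
    ∫⁻ y, ‖w g y‖ₑ ^ q * F (S g y) ∂ν = ∫⁻ y, F y ∂ν
  hone : ∀ᵐ y ∂ν, S 1 y = y ∧ w 1 y = 1
  hmul : ∀ g h, ∀ᵐ y ∂ν, S (g * h) y = S h (S g y) ∧ w (g * h) y = w g y * w h (S g y)
  hbfin : ∀ g, pInt ν q (b g) < ⊤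
  hbmul : ∀ g h, ∀ᵐ y ∂ν, b (g * h) y = b g y + w g y * b h (S g y)
  hbc : Tendsto (fun g => pInt ν q (b g)) (𝓝 1) (𝓝 0)

namespace NSData

variable {G : Type*} [Group G] [TopologicalSpace G] {ν : Measure Y} {q : ℝ}
variable (D : NSData G ν q)

lemma qmp (hq : 0 < q) (g : G) : Measure.QuasiMeasurePreserving (D.S g) ν ν := by
  refine ⟨D.hS g, ?_⟩
  refine Measure.AbsolutelyContinuous.mk fun s hs h0 => ?_
  rw [Measure.map_apply (D.hS g) hs]
  have h := D.hmap g (s.indicator 1) (measurable_one.indicator hs)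
  rw [lintegral_indicator_one hs, h0] at h
  have hm : Measurable fun y => ‖D.w g y‖ₑ ^ q * s.indicator 1 (D.S g y) := by
    have := D.hw g
    have h2 : Measurable fun y => s.indicator (1 : Y → ℝ≥0∞) (D.S g y) :=
      (measurable_one.indicator hs).comp (D.hS g)
    fun_prop
  rw [lintegral_eq_zero_iff hm] at h
  refine measure_mono_null ?_ h
  intro y hy
  have hy' : D.S g y ∈ s := hy
  have hw := D.hw0 g y
  simp [hy', ENNReal.rpow_eq_zero_iff, hq.le, hw.ne']

lemma pInt_V {E : Type*} [NormedAddCommGroup E] [NormedSpace ℝ E] [MeasurableSpace E]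
    [BorelSpace E] (hq : 0 < q) (g : G) {F : Y → E} (hF : AEMeasurable F ν) :
    pInt ν q (fun y => D.w g y • F (D.S g y)) = pInt ν q F := by
  have h1 : pInt ν q (fun y => D.w g y • F (D.S g y))
      = pInt ν q (fun y => D.w g y • hF.mk F (D.S g y)) := by
    refine pInt_congr ?_
    filter_upwards [(D.qmp hq g).ae hF.ae_eq_mk] with y hy
    rw [hy]
  have h2 : pInt ν q F = pInt ν q (hF.mk F) := by
    refine pInt_congr ?_
    filter_upwards [hF.ae_eq_mk] with y hy
    rw [hy]
  rw [h1, h2]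
  have := D.hmap g (fun y => ‖hF.mk F y‖ₑ ^ q) (by have := hF.measurable_mk; fun_prop)
  unfold pInt
  rw [← this]
  refine lintegral_congr fun y => ?_
  rw [enorm_smul, ENNReal.mul_rpow_of_nonneg _ _ hq.le]

/-- Continuous vectors. -/
def Cont {E : Type*} [NormedAddCommGroup E] [NormedSpace ℝ E] [MeasurableSpace E]
    (F : Y → E) : Prop :=
  AEMeasurable F ν ∧ pInt ν q F < ⊤ ∧
    Tendsto (fun g => pInt ν q (fun y => D.w g y • F (D.S g y) - F y)) (𝓝 1) (𝓝 0)

variable {D}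

lemma tendsto_zero_of_le {ι : Type*} {l : Filter ι} {f g : ι → ℝ≥0∞} (C : ℝ≥0∞) (hC : C ≠ ⊤)
    (hg : Tendsto g l (𝓝 0)) (h : ∀ i, f i ≤ C * g i) : Tendsto f l (𝓝 0) := by
  have h2 : Tendsto (fun i => C * g i) l (𝓝 0) := by
    have := ENNReal.Tendsto.const_mul (a := C) hg (Or.inr hC)
    simpa using this
  exact tendsto_of_tendsto_of_tendsto_of_le_of_le tendsto_const_nhds h2 (fun _ => zero_le) h

section
variable {E : Type*} [NormedAddCommGroup E] [NormedSpace ℝ E] [MeasurableSpace E]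
    [BorelSpace E] [SecondCountableTopology E]

lemma aem_V (hq : 0 < q) (D : NSData G ν q) (g : G) {F : Y → E} (hF : AEMeasurable F ν) :
    AEMeasurable (fun y => D.w g y • F (D.S g y)) ν := by
  have h1 : AEMeasurable (fun y => F (D.S g y)) ν := hF.comp_quasiMeasurePreserving (D.qmp hq g)
  exact (D.hw g).aemeasurable.smul h1

lemma Cont.congr (hq : 0 < q) {F H : Y → E} (hF : D.Cont F) (h : F =ᵐ[ν] H) : D.Cont H := by
  refine ⟨hF.1.congr h, ?_, ?_⟩
  · refine lt_of_eq_of_lt (pInt_congr ?_) hF.2.1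
    filter_upwards [h] with y hy
    rw [hy]
  · refine hF.2.2.congr fun g => pInt_congr ?_
    filter_upwards [h, (D.qmp hq g).ae h] with y hy hy2
    rw [hy, hy2]

lemma Cont.add (hq : 0 < q) {F H : Y → E} (hF : D.Cont F) (hH : D.Cont H) :
    D.Cont (fun y => F y + H y) := by
  refine ⟨hF.1.add hH.1, ?_, ?_⟩
  · refine (pInt_add_le hq hF.1).trans_lt ?_
    exact ENNReal.mul_lt_top (two_rpow_ne_top q).lt_top (ENNReal.add_lt_top.2 ⟨hF.2.1, hH.2.1⟩)
  · have := hF.2.2.add hH.2.2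
    rw [add_zero] at this
    refine tendsto_zero_of_le _ (two_rpow_ne_top q) this fun g => ?_
    refine le_trans (le_of_eq ?_) (pInt_add_le hq ((aem_V hq D g hF.1).sub hF.1))
    refine pInt_congr (ae_of_all _ fun y => ?_)
    congr 1
    simp only [smul_add, Pi.sub_apply]
    abel

lemma Cont.smul (hq : 0 < q) {F : Y → E} (hF : D.Cont F) (t : ℝ) :
    D.Cont (fun y => t • F y) := by
  have hC : ‖t‖ₑ ^ q ≠ ⊤ := by simp [hq.le]
  refine ⟨hF.1.const_smul t, ?_, ?_⟩
  · rw [pInt_smul hq]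
    exact ENNReal.mul_lt_top hC.lt_top hF.2.1
  · refine tendsto_zero_of_le _ hC hF.2.2 fun g => ?_
    rw [← pInt_smul hq]
    refine le_of_eq (pInt_congr (ae_of_all _ fun y => ?_))
    congr 1
    rw [smul_sub, smul_comm]

lemma Cont.sub (hq : 0 < q) {F H : Y → E} (hF : D.Cont F) (hH : D.Cont H) :
    D.Cont (fun y => F y - H y) := by
  have := hF.add hq (hH.smul hq (-1))
  simpa [sub_eq_add_neg] using this

lemma Cont.of_approx (hq : 0 < q) {F : Y → E} (hF : AEMeasurable F ν) (hF2 : pInt ν q F < ⊤)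
    (h : ∀ ε : ℝ≥0∞, 0 < ε → ∃ H : Y → E, D.Cont H ∧ pInt ν q (fun y => F y - H y) ≤ ε) :
    D.Cont F := by
  refine ⟨hF, hF2, ?_⟩
  rw [ENNReal.tendsto_nhds_zero]
  intro ε hε
  set K : ℝ≥0∞ := 2 ^ q * (2 ^ q * 2 + 1) with hK
  have hKtop : K ≠ ⊤ := by
    rw [hK]; finiteness [two_rpow_ne_top q]
  have hε' : 0 < ε / K := ENNReal.div_pos hε.ne' hKtop
  obtain ⟨H, hH, hFH⟩ := h (ε / K) hε'
  have hev := (ENNReal.tendsto_nhds_zero.1 hH.2.2) (ε / K) hε'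
  filter_upwards [hev] with g hg
  have hd : AEMeasurable (fun y => F y - H y) ν := hF.sub hH.1
  have e1 : pInt ν q (fun y => D.w g y • F (D.S g y) - F y)
      = pInt ν q (fun y => (D.w g y • (fun y => F y - H y) (D.S g y)
        + (fun y => (-1 : ℝ) • (F y - H y)) y) + (D.w g y • H (D.S g y) - H y)) := by
    refine pInt_congr (ae_of_all _ fun y => ?_)
    congr 1
    simp only [smul_sub, neg_smul, one_smul]
    abel
  rw [e1]
  refine (pInt_add_le hq ((aem_V hq D g hd).add (show AEMeasurable (fun y => (-1 : ℝ) • (F y - H y)) ν from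
    hd.const_smul (-1 : ℝ)))).trans ?_
  have e2 : pInt ν q (fun y => (-1 : ℝ) • (F y - H y)) = pInt ν q (fun y => F y - H y) := by
    rw [pInt_smul hq]; simp
  calc _ ≤ 2 ^ q * (2 ^ q * (ε / K + ε / K) + ε / K) := by
        gcongr
        refine (pInt_add_le hq (aem_V hq D g hd)).trans ?_
        rw [e2, D.pInt_V hq g hd]
        gcongr
    _ = K * (ε / K) := by rw [hK]; ring
    _ ≤ ε := ENNReal.mul_div_le

end

lemma Cont.abs (hq : 0 < q) {F : Y → ℝ} (hF : D.Cont F) : D.Cont (fun y => |F y|) := by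
  refine ⟨hF.1.abs, ?_, ?_⟩
  · refine lt_of_eq_of_lt (pInt_congr (ae_of_all _ fun y => ?_)) hF.2.1
    simp
  · refine tendsto_zero_of_le 1 one_ne_top hF.2.2 fun g => ?_
    rw [one_mul]
    refine pInt_mono hq (ae_of_all _ fun y => ?_)
    have h0 := D.hw0 g y
    rw [← ofReal_norm, ← ofReal_norm]
    refine ENNReal.ofReal_le_ofReal ?_
    simp only [smul_eq_mul, Real.norm_eq_abs]
    have : D.w g y * |F (D.S g y)| = |D.w g y * F (D.S g y)| := by
      rw [abs_mul, abs_of_pos h0]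
    rw [this]
    exact abs_abs_sub_abs_le_abs_sub _ _

lemma Cont.min (hq : 0 < q) {F H : Y → ℝ} (hF : D.Cont F) (hH : D.Cont H) :
    D.Cont (fun y => min (F y) (H y)) := by
  have := ((hF.add hq hH).sub hq ((hF.sub hq hH).abs hq)).smul hq (1 / 2)
  refine this.congr hq (ae_of_all _ fun y => ?_)
  simp only [smul_eq_mul]
  rcases le_total (F y) (H y) with h | h
  · rw [min_eq_left h, abs_of_nonpos (by linarith)]; ring
  · rw [min_eq_right h, abs_of_nonneg (by linarith)]; ring

lemma Cont.zero (hq : 0 < q) : D.Cont (fun _ => (0 : ℝ)) := by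
  refine ⟨by fun_prop, ?_, ?_⟩ <;> simp [pInt, hq]

lemma Cont.of_dominated (hq : 0 < q) {F B : Y → ℝ} (hB : AEMeasurable B ν)
    (hBfin : pInt ν q B < ⊤) {H : ℕ → Y → ℝ}
    (hH : ∀ n, D.Cont (H n)) (hle : ∀ n, ∀ᵐ y ∂ν, |H n y| ≤ |B y|)
    (hlim : ∀ᵐ y ∂ν, Tendsto (fun n => H n y) atTop (𝓝 (F y))) : D.Cont F := by
  have hF : AEMeasurable F ν := aemeasurable_of_tendsto_metrizable_ae atTop (fun n => (hH n).1) hlim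
  have hFB : ∀ᵐ y ∂ν, |F y| ≤ |B y| := by
    filter_upwards [hlim, ae_all_iff.2 hle] with y h1 h2
    exact le_of_tendsto h1.abs (Eventually.of_forall h2)
  have en : ∀ {a b : ℝ}, |a| ≤ |b| → ‖a‖ₑ ≤ ‖b‖ₑ := by
    intro a b hab
    rw [← ofReal_norm, ← ofReal_norm]
    exact ENNReal.ofReal_le_ofReal hab
  have hFfin : pInt ν q F < ⊤ :=
    (pInt_mono hq (hFB.mono fun y hy => en hy)).trans_lt hBfin
  refine Cont.of_approx hq hF hFfin fun ε hε => ?_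
  have hT : Tendsto (fun n => pInt ν q (fun y => F y - H n y)) atTop (𝓝 (∫⁻ y, 0 ∂ν)) := by
    unfold pInt
    refine tendsto_lintegral_of_dominated_convergence' (fun y => ‖2 * B y‖ₑ ^ q) (fun n => ?_)
      (fun n => ?_) ?_ ?_
    · have := (hH n).1
      fun_prop
    · filter_upwards [hFB, hle n] with y h1 h2
      refine ENNReal.rpow_le_rpow (en ?_) hq.le
      rw [abs_mul, abs_two]
      linarith [abs_sub (F y) (H n y)]
    · have := pInt_smul (ν := ν) hq (2 : ℝ) B
      unfold pInt at this
      simp only [smul_eq_mul] at this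
      rw [this]
      exact (ENNReal.mul_lt_top (ENNReal.rpow_lt_top_of_nonneg hq.le enorm_ne_top) hBfin).ne
    · filter_upwards [hlim] with y hy
      have h1 : Tendsto (fun n => F y - H n y) atTop (𝓝 0) := by
        simpa using (tendsto_const_nhds (x := F y)).sub hy
      have h2 := (ENNReal.continuous_rpow_const (y := q)).tendsto _ |>.comp h1.enorm
      simpa [hq, Function.comp_def] using h2
  simp only [lintegral_zero] at hT
  obtain ⟨n, hn⟩ := ((ENNReal.tendsto_nhds_zero.1 hT) ε hε).exists
  exact ⟨H n, hH n, hn⟩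

/-- positivity set times a continuous vector -/
lemma Cont.indicator_pos (hq : 0 < q) {F H : Y → ℝ} (hF : D.Cont F) (hF0 : ∀ᵐ y ∂ν, 0 ≤ F y)
    (hH : D.Cont H) : D.Cont ({y | 0 < H y}.indicator F) := by
  have hHp : D.Cont (fun y => |H y| + H y) := (hH.abs hq).add hq hH
  refine Cont.of_dominated hq hF.1 hF.2.1
    (H := fun n y => Min.min ((n : ℝ) • (|H y| + H y)) (F y))
    (fun n => (hHp.smul hq n).min hq hF) (fun n => ?_) ?_
  · filter_upwards [hF0] with y hy
    have h1 : 0 ≤ (n : ℝ) • (|H y| + H y) := by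
      have := neg_abs_le (H y)
      have h2 : (0 : ℝ) ≤ |H y| + H y := by linarith
      simp only [smul_eq_mul]; positivity
    rw [abs_of_nonneg hy, abs_of_nonneg (le_min h1 hy)]
    exact min_le_right _ _
  · filter_upwards [hF0] with y hy
    by_cases h : 0 < H y
    · rw [Set.indicator_of_mem (by exact h)]
      have hpos : 0 < |H y| + H y := by positivity
      refine tendsto_const_nhds.congr' ?_
      obtain ⟨N, hN⟩ := exists_nat_gt (F y / (|H y| + H y))
      filter_upwards [eventually_ge_atTop N] with n hn
      rw [min_eq_right]
      rw [div_lt_iff₀ hpos] at hN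
      simp only [smul_eq_mul]
      have : (N : ℝ) ≤ n := by exact_mod_cast hn
      nlinarith
    · rw [Set.indicator_of_notMem (by exact h)]
      push Not at h
      have : |H y| + H y = 0 := by rw [abs_of_nonpos h]; ring
      simp [this, hy]

/-- The σ-algebra of sets whose indicator times `F'` is continuous. -/
def sigE (D : NSData G ν q) (hq : 0 < q) {F' : Y → ℝ} (hF : D.Cont F') (hF0 : ∀ᵐ y ∂ν, 0 ≤ F' y) :
    MeasurableSpace Y where
  MeasurableSet' C := D.Cont (C.indicator F')
  measurableSet_empty := by
    simpa using Cont.zero hq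
  measurableSet_compl C hC := by
    refine (hF.sub hq hC).congr hq (ae_of_all _ fun y => ?_)
    by_cases h : y ∈ C <;> simp [h]
  measurableSet_iUnion f hf := by
    have hcompl : ∀ C : Set Y, D.Cont (C.indicator F') → D.Cont (Cᶜ.indicator F') := by
      intro C hC
      refine (hF.sub hq hC).congr hq (ae_of_all _ fun y => ?_)
      by_cases h : y ∈ C <;> simp [h]
    have h_cap : ∀ C C' : Set Y, D.Cont (C.indicator F') → D.Cont (C'.indicator F') →
        D.Cont ((C ∩ C').indicator F') := by
      intro C C' h1 h2
      refine (h1.min hq h2).congr hq ?_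
      filter_upwards [hF0] with y hy
      by_cases h : y ∈ C <;> by_cases h' : y ∈ C' <;> simp [h, h', hy]
    have hpart : ∀ n, D.Cont ((⋂ k ∈ Finset.range n, (f k)ᶜ).indicator F') := by
      intro n
      induction n with
      | zero => simpa using hF
      | succ n ih =>
        have : (⋂ k ∈ Finset.range (n + 1), (f k)ᶜ) = (⋂ k ∈ Finset.range n, (f k)ᶜ) ∩ (f n)ᶜ := by
          ext y
          simp only [Set.mem_iInter, Finset.mem_range, Set.mem_inter_iff]
          constructor
          · intro h
            exact ⟨fun k hk => h k (by omega), h n (by omega)⟩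
          · rintro ⟨h1, h2⟩ k hk
            rcases Nat.lt_succ_iff_lt_or_eq.1 hk with h | h
            · exact h1 k h
            · rw [h]; exact h2
        rw [this]
        exact h_cap _ _ ih (hcompl _ (hf n))
    have hlim : D.Cont ((⋂ k, (f k)ᶜ).indicator F') := by
      refine Cont.of_dominated hq hF.1 hF.2.1 hpart (fun n => ae_of_all _ fun y => ?_)
        (ae_of_all _ fun y => ?_)
      · by_cases h : y ∈ (⋂ k ∈ Finset.range n, (f k)ᶜ)
        · rw [Set.indicator_of_mem h]
        · rw [Set.indicator_of_notMem h]; simp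
      · by_cases h : y ∈ ⋂ k, (f k)ᶜ
        · rw [Set.indicator_of_mem h]
          refine tendsto_const_nhds.congr fun n => ?_
          rw [Set.indicator_of_mem]
          simp only [Set.mem_iInter] at h ⊢
          exact fun k _ => h k
        · rw [Set.indicator_of_notMem h]
          simp only [Set.mem_iInter, not_forall] at h
          obtain ⟨k, hk⟩ := h
          refine tendsto_const_nhds.congr' ?_
          filter_upwards [eventually_gt_atTop k] with n hn
          rw [Set.indicator_of_notMem]
          simp only [Set.mem_iInter, not_forall]
          exact ⟨k, by simpa using hn, hk⟩
    have := hcompl _ hlim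
    rwa [Set.compl_iInter, show (⋃ i, (f i)ᶜᶜ) = ⋃ i, f i by simp] at this

lemma cont_of_sigE (hq : 0 < q) {F' : Y → ℝ} (hF : D.Cont F') (hF0 : ∀ᵐ y ∂ν, 0 < F' y)
    (hF00 : ∀ᵐ y ∂ν, 0 ≤ F' y)
    (hle : ‹MeasurableSpace Y› ≤ sigE D hq hF hF00) {F : Y → ℝ} (hFm : AEMeasurable F ν)
    (hFfin : pInt ν q F < ⊤) : D.Cont F := by
  have hsimple : ∀ φ : SimpleFunc Y ℝ, D.Cont (fun y => φ y * F' y) := by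
    intro φ
    induction φ using SimpleFunc.induction with
    | const c hs =>
      rename_i s
      have h1 : D.Cont (s.indicator F') := hle _ hs
      refine (h1.smul hq c).congr hq (ae_of_all _ fun y => ?_)
      by_cases h : y ∈ s <;> simp [h]
    | add hd h1 h2 =>
      refine (h1.add hq h2).congr hq (ae_of_all _ fun y => ?_)
      simp [add_mul]
  set φ : Y → ℝ := fun y => hFm.mk F y / hF.1.mk F' y with hφ
  have hφm : Measurable φ := hFm.measurable_mk.div hF.1.measurable_mk
  have hB : pInt ν q (fun y => (2 : ℝ) • F y) < ⊤ := by
    rw [pInt_smul hq]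
    exact ENNReal.mul_lt_top (ENNReal.rpow_lt_top_of_nonneg hq.le enorm_ne_top) hFfin
  have hφF : ∀ᵐ y ∂ν, φ y * F' y = F y := by
    filter_upwards [hFm.ae_eq_mk, hF.1.ae_eq_mk, hF0] with y h1 h2 h3
    rw [hφ]; simp only
    rw [← h1, ← h2]
    field_simp
  refine Cont.of_dominated hq (hFm.const_smul (2 : ℝ)) hB
    (H := fun n y => SimpleFunc.approxOn φ hφm Set.univ 0 (Set.mem_univ _) n y * F' y)
    (fun n => hsimple _) (fun n => ?_) ?_
  · filter_upwards [hφF] with y hy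
    have := SimpleFunc.norm_approxOn_zero_le hφm (Set.mem_univ 0) y n
    simp only [Pi.smul_apply, smul_eq_mul]
    rw [← hy, abs_mul, abs_mul, abs_mul, abs_two]
    simp only [Real.norm_eq_abs] at this
    nlinarith [abs_nonneg (F' y)]
  · filter_upwards [hφF] with y hy
    rw [← hy]
    refine Tendsto.mul_const _ ?_
    exact SimpleFunc.tendsto_approxOn hφm (Set.mem_univ _) (by simp)

lemma cont_complex (hq : 0 < q) (hall : ∀ F : Y → ℝ, AEMeasurable F ν → pInt ν q F < ⊤ → D.Cont F)
    {F : Y → ℂ} (hF : AEMeasurable F ν) (hFfin : pInt ν q F < ⊤) : D.Cont F := by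
  have hre : D.Cont (fun y => (F y).re) := by
    refine hall _ (by fun_prop) ((pInt_mono hq (ae_of_all _ fun y => ?_)).trans_lt hFfin)
    rw [← ofReal_norm, ← ofReal_norm]
    exact ENNReal.ofReal_le_ofReal (Complex.abs_re_le_norm _)
  have him : D.Cont (fun y => (F y).im) := by
    refine hall _ (by fun_prop) ((pInt_mono hq (ae_of_all _ fun y => ?_)).trans_lt hFfin)
    rw [← ofReal_norm, ← ofReal_norm]
    exact ENNReal.ofReal_le_ofReal (Complex.abs_im_le_norm _)
  refine ⟨hF, hFfin, ?_⟩
  have h0 := hre.2.2.add him.2.2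
  rw [add_zero] at h0
  refine tendsto_zero_of_le _ (two_rpow_ne_top q) h0 fun g => ?_
  have e1 : pInt ν q (fun y => D.w g y • (F (D.S g y)).im - (F y).im)
     = pInt ν q (fun y => ((D.w g y • (F (D.S g y)).im - (F y).im : ℝ) : ℂ) * Complex.I) := by
    refine pInt_congr (ae_of_all _ fun y => ?_)
    rw [← ofReal_norm, ← ofReal_norm]
    rw [norm_mul, Complex.norm_real]
    simp
  have e2 : pInt ν q (fun y => D.w g y • (F (D.S g y)).re - (F y).re)
     = pInt ν q (fun y => ((D.w g y • (F (D.S g y)).re - (F y).re : ℝ) : ℂ)) := by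
    refine pInt_congr (ae_of_all _ fun y => ?_)
    rw [← ofReal_norm, ← ofReal_norm, Complex.norm_real]
  rw [e1, e2]
  refine le_trans (le_of_eq ?_) (pInt_add_le hq ?_)
  · refine pInt_congr (ae_of_all _ fun y => ?_)
    congr 1
    apply Complex.ext <;> simp
  · have := (aem_V hq D g hre.1).sub hre.1
    exact Complex.measurable_ofReal.comp_aemeasurable this

end NSData
end basic


namespace NSData
open Filter Topology
variable {Y : Type*} [MeasurableSpace Y]
variable {G : Type*} [Group G] [TopologicalSpace G] {ν : Measure Y} {q : ℝ}

/-- The affine action on functions. -/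
noncomputable def actFun (D : NSData G ν q) (g : G) (F : Y → ℂ) : Y → ℂ :=
  fun y => D.w g y • F (D.S g y) + (D.b g y : ℂ)

lemma pInt_b (D : NSData G ν q) (g : G) :
    pInt ν q (fun y => (D.b g y : ℂ)) = pInt ν q (D.b g) := by
  refine pInt_congr (ae_of_all _ fun y => ?_)
  rw [← ofReal_norm, ← ofReal_norm, Complex.norm_real]

lemma actFun_memLp (D : NSData G ν q) (hq : 0 < q) (g : G) (F : Lp ℂ (ENNReal.ofReal q) ν) :
    MemLp (D.actFun g F) (ENNReal.ofReal q) ν := by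
  have hF := Lp.memLp F
  have hFm : AEMeasurable (F : Y → ℂ) ν := hF.1.aemeasurable
  have h1 := aem_V hq D g hFm
  have hb := D.hb g
  have hm : AEMeasurable (D.actFun g F) ν := by
    unfold actFun
    exact h1.add (by fun_prop)
  refine (memLp_iff_pInt hq hm.aestronglyMeasurable).2 ?_
  refine (pInt_add_le hq h1).trans_lt ?_
  rw [D.pInt_V hq g hFm, D.pInt_b]
  exact ENNReal.mul_lt_top (two_rpow_ne_top q).lt_top
    (ENNReal.add_lt_top.2 ⟨(memLp_iff_pInt hq hF.1).1 hF, D.hbfin g⟩)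

/-- The affine action on `Lp`. -/
noncomputable def actLp (D : NSData G ν q) (hq : 0 < q) (g : G) (F : Lp ℂ (ENNReal.ofReal q) ν) :
    Lp ℂ (ENNReal.ofReal q) ν := (D.actFun_memLp hq g F).toLp _

lemma coe_actLp (D : NSData G ν q) (hq : 0 < q) (g : G) (F : Lp ℂ (ENNReal.ofReal q) ν) :
    (D.actLp hq g F : Y → ℂ) =ᵐ[ν] D.actFun g F := MemLp.coeFn_toLp _

lemma b_one (D : NSData G ν q) : ∀ᵐ y ∂ν, D.b 1 y = 0 := by
  filter_upwards [D.hbmul 1 1, D.hone] with y h1 h2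
  rw [mul_one, h2.1, h2.2] at h1
  linarith

lemma actLp_one (D : NSData G ν q) (hq : 0 < q) (F : Lp ℂ (ENNReal.ofReal q) ν) :
    D.actLp hq 1 F = F := by
  apply Lp.ext
  filter_upwards [D.coe_actLp hq 1 F, D.hone, D.b_one] with y h1 h2 h3
  rw [h1]
  simp [actFun, h2.1, h2.2, h3]

lemma actLp_mul (D : NSData G ν q) (hq : 0 < q) (g h : G) (F : Lp ℂ (ENNReal.ofReal q) ν) :
    D.actLp hq (g * h) F = D.actLp hq g (D.actLp hq h F) := by
  apply Lp.ext
  filter_upwards [D.coe_actLp hq (g * h) F, D.coe_actLp hq g (D.actLp hq h F),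
    (D.qmp hq g).ae (D.coe_actLp hq h F), D.hmul g h, D.hbmul g h] with y h1 h2 h3 h4 h5
  rw [h1, h2]
  simp only [actFun]
  rw [h3, h4.1, h4.2, h5]
  simp only [actFun, Complex.real_smul]
  push_cast
  ring

lemma pInt_sub (D : NSData G ν q) (hq : 0 < q) (g : G) (F H : Lp ℂ (ENNReal.ofReal q) ν) :
    pPow ν q ((D.actLp hq g F : Y →ₘ[ν] ℂ) - (D.actLp hq g H : Y →ₘ[ν] ℂ))
      = pPow ν q ((F : Y →ₘ[ν] ℂ) - (H : Y →ₘ[ν] ℂ)) := by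
  rw [pPow_eq_pInt, pPow_eq_pInt]
  have hm : AEMeasurable (((F : Y →ₘ[ν] ℂ) - (H : Y →ₘ[ν] ℂ) : Y →ₘ[ν] ℂ) : Y → ℂ) ν :=
    (AEEqFun.aemeasurable _)
  rw [← D.pInt_V hq g hm]
  refine pInt_congr ?_
  filter_upwards [D.coe_actLp hq g F, D.coe_actLp hq g H,
    AEEqFun.coeFn_sub (D.actLp hq g F : Y →ₘ[ν] ℂ) (D.actLp hq g H : Y →ₘ[ν] ℂ),
    (D.qmp hq g).ae (AEEqFun.coeFn_sub (F : Y →ₘ[ν] ℂ) (H : Y →ₘ[ν] ℂ))] with y h1 h2 h3 h4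
  rw [h3, h4]
  simp only [Pi.sub_apply]
  rw [h1, h2]
  simp only [actFun, smul_sub]
  congr 1
  ring

theorem exists_action [IsTopologicalGroup G] (D : NSData G ν q) (hq : 0 < q)
    (hall : ∀ F : Y → ℝ, AEMeasurable F ν → pInt ν q F < ⊤ → D.Cont F)
    (hprop : ∀ R : ℝ≥0∞, R ≠ ⊤ → IsCompact (closure {g : G | pInt ν q (D.b g) ≤ R})) :
    ∃ β : AffineIsometricAction G ν q, β.MetricallyProper := by
  have hc1 : ∀ F : Lp ℂ (ENNReal.ofReal q) ν, Tendsto (fun g =>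
      pPow ν q ((D.actLp hq g F : Y →ₘ[ν] ℂ) - (F : Y →ₘ[ν] ℂ))) (𝓝 1) (𝓝 0) := by
    intro F
    have hF := Lp.memLp F
    have hFm : AEMeasurable (F : Y → ℂ) ν := hF.1.aemeasurable
    have hC := cont_complex hq hall hFm ((memLp_iff_pInt hq hF.1).1 hF)
    have h0 := hC.2.2.add D.hbc
    rw [add_zero] at h0
    refine tendsto_zero_of_le _ (two_rpow_ne_top q) h0 fun g => ?_
    rw [← D.pInt_b, pPow_eq_pInt]
    refine le_trans (le_of_eq ?_) (pInt_add_le hq ((aem_V hq D g hFm).sub hFm))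
    refine pInt_congr ?_
    filter_upwards [D.coe_actLp hq g F,
      AEEqFun.coeFn_sub (D.actLp hq g F : Y →ₘ[ν] ℂ) (F : Y →ₘ[ν] ℂ)] with y h1 h2
    rw [h2]
    simp only [Pi.sub_apply]
    rw [h1]
    simp only [actFun]
    congr 1
    ring
  refine ⟨⟨D.actLp hq, D.actLp_one hq, D.actLp_mul hq, D.pInt_sub hq, ?_, ?_⟩, ?_⟩
  · intro g t F H
    apply Lp.ext
    filter_upwards [D.coe_actLp hq g (t • F + (1 - t) • H), D.coe_actLp hq g F,
      D.coe_actLp hq g H,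
      Lp.coeFn_add (t • D.actLp hq g F) ((1 - t) • D.actLp hq g H),
      Lp.coeFn_smul t (D.actLp hq g F), Lp.coeFn_smul (1 - t) (D.actLp hq g H),
      (D.qmp hq g).ae (Lp.coeFn_add (t • F) ((1 - t) • H)),
      (D.qmp hq g).ae (Lp.coeFn_smul t F),
      (D.qmp hq g).ae (Lp.coeFn_smul (1 - t) H)] with y h1 h2 h3 h4 h5 h6 h7 h8 h9
    rw [h1, h4]
    simp only [Pi.add_apply]
    rw [h5, h6]
    simp only [Pi.smul_apply]
    rw [h2, h3]
    simp only [actFun]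
    rw [h7]
    simp only [Pi.add_apply]
    rw [h8, h9]
    simp only [Pi.smul_apply, Complex.real_smul]
    push_cast
    ring
  · intro F g₀
    have ht : Tendsto (fun g : G => g₀⁻¹ * g) (𝓝 g₀) (𝓝 1) := by
      have : Continuous fun g : G => g₀⁻¹ * g := by fun_prop
      simpa using this.tendsto g₀
    refine ((hc1 F).comp ht).congr fun g => ?_
    simp only [Function.comp_apply]
    rw [← D.pInt_sub hq g₀, ← D.actLp_mul hq]
    simp
  · intro R hR
    have := hprop R hR
    have hs : {g : G | pPow ν q ((D.actLp hq g 0 : Y →ₘ[ν] ℂ)) ≤ R}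
        = {g : G | pInt ν q (D.b g) ≤ R} := by
      ext g
      simp only [Set.mem_setOf_eq]
      have : pPow ν q ((D.actLp hq g 0 : Y →ₘ[ν] ℂ)) = pInt ν q (D.b g) := by
        rw [pPow_eq_pInt, ← D.pInt_b]
        refine pInt_congr ?_
        filter_upwards [D.coe_actLp hq g 0,
          (D.qmp hq g).ae (Lp.coeFn_zero ℂ (ENNReal.ofReal q) ν)] with y h1 h2
        rw [h1]
        simp only [actFun]
        rw [h2]
        simp
      rw [this]
    rw [← hs] at this
    exact this

end NSData


section clarkson

lemma rpow_half_sq (z : ℂ) (p : ℝ) : ‖z‖ ^ p = (‖z‖ ^ 2) ^ (p / 2) := by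
  rw [← Real.rpow_natCast, ← Real.rpow_mul (norm_nonneg _)]
  congr 1
  push_cast; ring

lemma parallelogram_c (z w : ℂ) : (‖z + w‖ ^ 2 + ‖z - w‖ ^ 2) / 2 = ‖z‖ ^ 2 + ‖w‖ ^ 2 := by
  have := parallelogram_law_with_norm ℝ z w
  nlinarith

lemma strict_sub {θ a b : ℝ} (hθ : 0 < θ) (h1 : θ < 1) (ha : 0 < a) (hb : 0 < b) :
    (a + b) ^ θ < a ^ θ + b ^ θ := by
  have hab : 0 < a + b := by positivity
  have e1 : a / (a + b) < (a / (a + b)) ^ θ := by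
    have := Real.rpow_lt_rpow_of_exponent_gt (x := a / (a + b)) (by positivity)
      (by rw [div_lt_one hab]; linarith) h1
    simpa using this
  have e2 : b / (a + b) < (b / (a + b)) ^ θ := by
    have := Real.rpow_lt_rpow_of_exponent_gt (x := b / (a + b)) (by positivity)
      (by rw [div_lt_one hab]; linarith) h1
    simpa using this
  have e3 : a / (a + b) + b / (a + b) = 1 := by field_simp
  rw [Real.div_rpow ha.le hab.le] at e1
  rw [Real.div_rpow hb.le hab.le] at e2
  have hp : 0 < (a + b) ^ θ := by positivity
  have : 1 < a ^ θ / (a + b) ^ θ + b ^ θ / (a + b) ^ θ := by linarith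
  rw [← add_div, lt_div_iff₀ hp] at this
  linarith

lemma strict_super {θ a b : ℝ} (h1 : 1 < θ) (ha : 0 < a) (hb : 0 < b) :
    a ^ θ + b ^ θ < (a + b) ^ θ := by
  have hab : 0 < a + b := by positivity
  have e1 : (a / (a + b)) ^ θ < a / (a + b) := by
    have := Real.rpow_lt_rpow_of_exponent_gt (x := a / (a + b)) (by positivity)
      (by rw [div_lt_one hab]; linarith) h1
    simpa using this
  have e2 : (b / (a + b)) ^ θ < b / (a + b) := by
    have := Real.rpow_lt_rpow_of_exponent_gt (x := b / (a + b)) (by positivity)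
      (by rw [div_lt_one hab]; linarith) h1
    simpa using this
  have e3 : a / (a + b) + b / (a + b) = 1 := by field_simp
  rw [Real.div_rpow ha.le hab.le] at e1
  rw [Real.div_rpow hb.le hab.le] at e2
  have hp : 0 < (a + b) ^ θ := by positivity
  have : a ^ θ / (a + b) ^ θ + b ^ θ / (a + b) ^ θ < 1 := by linarith
  rw [← add_div, div_lt_one hp] at this
  linarith

lemma clarkson_eq {p : ℝ} (hp : 0 < p) {z w : ℂ} (h : z = 0 ∨ w = 0) :
    ‖z + w‖ ^ p + ‖z - w‖ ^ p = 2 * (‖z‖ ^ p + ‖w‖ ^ p) := by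
  rcases h with h | h <;> simp [h, Real.zero_rpow hp.ne'] <;> ring

lemma clarkson_lt {p : ℝ} (hp : 0 < p) (hp2 : p < 2) {z w : ℂ} (hz : z ≠ 0) (hw : w ≠ 0) :
    ‖z + w‖ ^ p + ‖z - w‖ ^ p < 2 * (‖z‖ ^ p + ‖w‖ ^ p) := by
  simp only [rpow_half_sq _ p]
  have h1 := strict_sub (θ := p / 2) (a := ‖z‖ ^ 2) (b := ‖w‖ ^ 2) (by linarith) (by linarith)
    (by positivity) (by positivity)
  rw [← parallelogram_c] at h1
  have h2 := (Real.concaveOn_rpow (p := p / 2) (by linarith) (by linarith)).2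
    (show ‖z + w‖ ^ 2 ∈ Set.Ici (0 : ℝ) by simp) (show ‖z - w‖ ^ 2 ∈ Set.Ici (0 : ℝ) by simp)
    (show (0 : ℝ) ≤ 1 / 2 by norm_num) (show (0 : ℝ) ≤ 1 / 2 by norm_num) (by norm_num)
  simp only [smul_eq_mul] at h2
  have e : 1 / 2 * ‖z + w‖ ^ 2 + 1 / 2 * ‖z - w‖ ^ 2 = (‖z + w‖ ^ 2 + ‖z - w‖ ^ 2) / 2 := by ring
  rw [e] at h2
  linarith

lemma clarkson_gt {p : ℝ} (hp2 : 2 < p) {z w : ℂ} (hz : z ≠ 0) (hw : w ≠ 0) :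
    2 * (‖z‖ ^ p + ‖w‖ ^ p) < ‖z + w‖ ^ p + ‖z - w‖ ^ p := by
  simp only [rpow_half_sq _ p]
  have h1 := strict_super (θ := p / 2) (a := ‖z‖ ^ 2) (b := ‖w‖ ^ 2) (by linarith)
    (by positivity) (by positivity)
  rw [← parallelogram_c] at h1
  have h2 := (convexOn_rpow (p := p / 2) (by linarith)).2
    (show ‖z + w‖ ^ 2 ∈ Set.Ici (0 : ℝ) by simp) (show ‖z - w‖ ^ 2 ∈ Set.Ici (0 : ℝ) by simp)
    (show (0 : ℝ) ≤ 1 / 2 by norm_num) (show (0 : ℝ) ≤ 1 / 2 by norm_num) (by norm_num)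
  simp only [smul_eq_mul] at h2
  have e : 1 / 2 * ‖z + w‖ ^ 2 + 1 / 2 * ‖z - w‖ ^ 2 = (‖z + w‖ ^ 2 + ‖z - w‖ ^ 2) / 2 := by ring
  rw [e] at h2
  linarith

lemma enorm_rpow_c {p : ℝ} (hp : 0 < p) (z : ℂ) : ‖z‖ₑ ^ p = ENNReal.ofReal (‖z‖ ^ p) := by
  rw [← ofReal_norm, ENNReal.ofReal_rpow_of_nonneg (norm_nonneg _) hp.le]

variable {X : Type*} [MeasurableSpace X] {μ : Measure X} {p : ℝ}

lemma disj_iff_pInt (hp : 0 < p) (hp2 : p ≠ 2) {F H : X → ℂ} (hF : AEMeasurable F μ)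
    (hH : AEMeasurable H μ) (hFf : pInt μ p F < ⊤) (hHf : pInt μ p H < ⊤) :
    (∀ᵐ x ∂μ, F x = 0 ∨ H x = 0) ↔
      pInt μ p (fun x => F x + H x) + pInt μ p (fun x => F x - H x)
        = 2 * (pInt μ p F + pInt μ p H) := by
  have e1 : pInt μ p (fun x => F x + H x) + pInt μ p (fun x => F x - H x)
      = ∫⁻ x, ENNReal.ofReal (‖F x + H x‖ ^ p + ‖F x - H x‖ ^ p) ∂μ := by
    unfold pInt
    rw [← lintegral_add_left' (by fun_prop)]
    refine lintegral_congr fun x => ?_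
    rw [enorm_rpow_c hp, enorm_rpow_c hp, ENNReal.ofReal_add (by positivity) (by positivity)]
  have e2 : 2 * (pInt μ p F + pInt μ p H)
      = ∫⁻ x, ENNReal.ofReal (2 * (‖F x‖ ^ p + ‖H x‖ ^ p)) ∂μ := by
    unfold pInt
    rw [← lintegral_add_left' (by fun_prop), ← lintegral_const_mul' _ _ (by simp)]
    refine lintegral_congr fun x => ?_
    rw [enorm_rpow_c hp, enorm_rpow_c hp, ENNReal.ofReal_mul (by positivity),
      ENNReal.ofReal_add (by positivity) (by positivity)]
    simp
  have hfin2 : 2 * (pInt μ p F + pInt μ p H) ≠ ⊤ := by finiteness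
  constructor
  · intro h
    rw [e1, e2]
    refine lintegral_congr_ae ?_
    filter_upwards [h] with x hx
    rw [clarkson_eq hp hx]
  · intro h
    have hfin1 := hfin2
    rw [← h] at hfin1
    rw [e1, e2] at h
    rw [e1] at hfin1
    rw [e2] at hfin2
    rcases lt_or_gt_of_ne hp2 with h2 | h2
    · have hle : ∀ z w : ℂ, ‖z + w‖ ^ p + ‖z - w‖ ^ p ≤ 2 * (‖z‖ ^ p + ‖w‖ ^ p) := by
        intro z w
        by_cases hz : z = 0
        · exact (clarkson_eq hp (Or.inl hz)).le
        by_cases hw : w = 0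
        · exact (clarkson_eq hp (Or.inr hw)).le
        exact (clarkson_lt hp h2 hz hw).le
      have := ae_eq_of_ae_le_of_lintegral_le
        (ae_of_all μ fun x => ENNReal.ofReal_le_ofReal (hle (F x) (H x)))
        hfin1 (by fun_prop) h.ge
      filter_upwards [this] with x hx
      by_contra! hc
      have h3 := clarkson_lt hp h2 hc.1 hc.2
      rw [ENNReal.ofReal_eq_ofReal_iff (by positivity) (by positivity)] at hx
      linarith
    · have hle : ∀ z w : ℂ, 2 * (‖z‖ ^ p + ‖w‖ ^ p) ≤ ‖z + w‖ ^ p + ‖z - w‖ ^ p := by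
        intro z w
        by_cases hz : z = 0
        · exact (clarkson_eq hp (Or.inl hz)).ge
        by_cases hw : w = 0
        · exact (clarkson_eq hp (Or.inr hw)).ge
        exact (clarkson_gt h2 hz hw).le
      have := ae_eq_of_ae_le_of_lintegral_le
        (ae_of_all μ fun x => ENNReal.ofReal_le_ofReal (hle (F x) (H x)))
        hfin2 (by fun_prop) h.le
      filter_upwards [this] with x hx
      by_contra! hc
      have h3 := clarkson_gt h2 hc.1 hc.2
      rw [ENNReal.ofReal_eq_ofReal_iff (by positivity) (by positivity)] at hx
      linarith

end clarkson


section lamperti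
open Filter Topology

variable {X : Type*} [MeasurableSpace X]

/-- A measurable function with finite `p`-integral. -/
def InL (μ : Measure X) (p : ℝ) (F : X → ℂ) : Prop := Measurable F ∧ pInt μ p F < ⊤

/-- A surjective real-linear isometric operator on `L_p`, acting on representatives. -/
structure IsoOp (μ : Measure X) (p : ℝ) (T : (X → ℂ) → (X → ℂ)) : Prop where
  mem : ∀ F, InL μ p F → InL μ p (T F)
  congr : ∀ F H, InL μ p F → InL μ p H → F =ᵐ[μ] H → T F =ᵐ[μ] T H
  add : ∀ F H, InL μ p F → InL μ p H → ∀ᵐ x ∂μ, T (fun x => F x + H x) x = T F x + T H x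
  smul : ∀ (t : ℝ) F, InL μ p F → ∀ᵐ x ∂μ, T (fun x => t • F x) x = t • T F x
  iso : ∀ F, InL μ p F → pInt μ p (T F) = pInt μ p F
  surj : ∀ F, InL μ p F → ∃ H, InL μ p H ∧ T H =ᵐ[μ] F

variable {μ : Measure X} {p : ℝ}

lemma InL.add (hp : 0 < p) {F H : X → ℂ} (hF : InL μ p F) (hH : InL μ p H) :
    InL μ p (fun x => F x + H x) := by
  refine ⟨hF.1.add hH.1, (pInt_add_le hp hF.1.aemeasurable).trans_lt ?_⟩
  exact ENNReal.mul_lt_top (two_rpow_ne_top p).lt_top (ENNReal.add_lt_top.2 ⟨hF.2, hH.2⟩)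

lemma InL.mono (hp : 0 < p) {F H : X → ℂ} (hF : InL μ p F) (hH : Measurable H)
    (h : ∀ x, ‖H x‖ ≤ ‖F x‖) : InL μ p H := by
  refine ⟨hH, (pInt_mono hp (ae_of_all _ fun x => ?_)).trans_lt hF.2⟩
  rw [← ofReal_norm, ← ofReal_norm]
  exact ENNReal.ofReal_le_ofReal (h x)

lemma InL.smul (hp : 0 < p) {F : X → ℂ} (hF : InL μ p F) (t : ℝ) :
    InL μ p (fun x => t • F x) := by
  refine ⟨hF.1.const_smul t, ?_⟩
  rw [pInt_smul hp]
  exact ENNReal.mul_lt_top (ENNReal.rpow_lt_top_of_nonneg hp.le enorm_ne_top) hF.2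

lemma InL.indicator (hp : 0 < p) {F : X → ℂ} (hF : InL μ p F) {A : Set X} (hA : MeasurableSet A) :
    InL μ p (A.indicator F) := by
  refine hF.mono hp (hF.1.indicator hA) fun x => ?_
  by_cases h : x ∈ A <;> simp [h]

lemma InL.sub (hp : 0 < p) {F H : X → ℂ} (hF : InL μ p F) (hH : InL μ p H) :
    InL μ p (fun x => F x - H x) := by
  have := hF.add hp (hH.smul hp (-1))
  simpa [sub_eq_add_neg] using this

lemma pInt_eq_zero_iff (hp : 0 < p) {F : X → ℂ} (hF : Measurable F) :
    pInt μ p F = 0 ↔ ∀ᵐ x ∂μ, F x = 0 := by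
  unfold pInt
  rw [lintegral_eq_zero_iff (by fun_prop)]
  constructor <;> intro h <;> filter_upwards [h] with x hx
  · simpa [ENNReal.rpow_eq_zero_iff, hp, hp.le, not_lt.2 hp.le] using hx
  · simp [hx, hp]

namespace IsoOp

variable {T : (X → ℂ) → (X → ℂ)}

lemma sub (hT : IsoOp μ p T) (hp : 0 < p) {F H : X → ℂ} (hF : InL μ p F) (hH : InL μ p H) :
    ∀ᵐ x ∂μ, T (fun x => F x - H x) x = T F x - T H x := by
  have h1 := hT.add F _ hF (hH.smul hp (-1))
  have h2 := hT.smul (-1) H hH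
  have e : (fun x => F x + (-1 : ℝ) • H x) = fun x => F x - H x := by
    ext x; simp [sub_eq_add_neg]
  rw [e] at h1
  filter_upwards [h1, h2] with x h1 h2
  rw [h1, h2]
  simp [sub_eq_add_neg]

lemma eq_zero_iff (hT : IsoOp μ p T) (hp : 0 < p) {F : X → ℂ} (hF : InL μ p F) :
    (∀ᵐ x ∂μ, T F x = 0) ↔ ∀ᵐ x ∂μ, F x = 0 := by
  rw [← pInt_eq_zero_iff hp hF.1, ← pInt_eq_zero_iff hp (hT.mem F hF).1, hT.iso F hF]

lemma disj (hT : IsoOp μ p T) (hp : 0 < p) (hp2 : p ≠ 2) {F H : X → ℂ} (hF : InL μ p F)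
    (hH : InL μ p H) :
    (∀ᵐ x ∂μ, T F x = 0 ∨ T H x = 0) ↔ ∀ᵐ x ∂μ, F x = 0 ∨ H x = 0 := by
  have hTF := hT.mem F hF
  have hTH := hT.mem H hH
  rw [disj_iff_pInt hp hp2 hTF.1.aemeasurable hTH.1.aemeasurable hTF.2 hTH.2,
    disj_iff_pInt hp hp2 hF.1.aemeasurable hH.1.aemeasurable hF.2 hH.2,
    hT.iso F hF, hT.iso H hH, ← hT.iso _ (hF.add hp hH), ← hT.iso _ (hF.sub hp hH)]
  have e1 : pInt μ p (fun x => T F x + T H x) = pInt μ p (T fun x => F x + H x) := by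
    refine pInt_congr ?_
    filter_upwards [hT.add F H hF hH] with x hx
    rw [hx]
  have e2 : pInt μ p (fun x => T F x - T H x) = pInt μ p (T fun x => F x - H x) := by
    refine pInt_congr ?_
    filter_upwards [hT.sub hp hF hH] with x hx
    rw [hx]
  rw [e1, e2]

/-- A set on which enough images vanish is null. -/
lemma null_of (hT : IsoOp μ p T) (hp : 0 < p) (hp2 : p ≠ 2) {h : X → ℂ} (hh : InL μ p h)
    (hh0 : ∀ x, h x ≠ 0) {ι : Type*} [Countable ι] (F : ι → X → ℂ) (hF : ∀ i, InL μ p (F i))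
    (hcov : ∀ x, ∃ i, F i x ≠ 0) {Z : Set X} (hZ : MeasurableSet Z)
    (hz : ∀ i, ∀ᵐ x ∂μ, x ∈ Z → T (F i) x = 0) : ∀ᵐ x ∂μ, x ∉ Z := by
  obtain ⟨H, hH, hTH⟩ := hT.surj _ (hh.indicator hp hZ)
  have h1 : ∀ i, ∀ᵐ x ∂μ, H x = 0 ∨ F i x = 0 := by
    intro i
    rw [← hT.disj hp hp2 hH (hF i)]
    filter_upwards [hz i, hTH] with x h1 h2
    by_cases hx : x ∈ Z
    · exact Or.inr (h1 hx)
    · left; rw [h2]; simp [hx]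
  have h2 : ∀ᵐ x ∂μ, H x = 0 := by
    filter_upwards [ae_all_iff.2 h1] with x hx
    obtain ⟨i, hi⟩ := hcov x
    exact (hx i).resolve_right hi
  filter_upwards [(hT.eq_zero_iff hp hH).2 h2, hTH] with x h3 h4 hx
  rw [h3, Set.indicator_of_mem hx] at h4
  exact hh0 x h4.symm

lemma Th_ne (hT : IsoOp μ p T) (hp : 0 < p) (hp2 : p ≠ 2) {h : X → ℂ} (hh : InL μ p h)
    (hh0 : ∀ x, h x ≠ 0) : ∀ᵐ x ∂μ, T h x ≠ 0 := by
  refine hT.null_of hp hp2 hh hh0 (fun _ : Unit => h) (fun _ => hh) (fun x => ⟨(), hh0 x⟩)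
    (Z := {x | T h x = 0}) ((hT.mem h hh).1 (measurableSet_singleton 0)) (fun _ => ?_)
  exact ae_of_all _ fun x hx => hx

/-- The set map. -/
def th (T : (X → ℂ) → (X → ℂ)) (h : X → ℂ) (A : Set X) : Set X := {x | T (A.indicator h) x ≠ 0}

lemma split (hT : IsoOp μ p T) (hp : 0 < p) {F : X → ℂ} (hF : InL μ p F) {A : Set X}
    (hA : MeasurableSet A) :
    ∀ᵐ x ∂μ, T F x = T (A.indicator F) x + T (Aᶜ.indicator F) x := by
  have := hT.add _ _ (hF.indicator hp hA) (hF.indicator hp hA.compl)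
  have e : (fun x => A.indicator F x + Aᶜ.indicator F x) = F := by
    ext x; by_cases h : x ∈ A <;> simp [h]
  rwa [e] at this

lemma disj_ind (hT : IsoOp μ p T) (hp : 0 < p) (hp2 : p ≠ 2) {F H : X → ℂ} (hF : InL μ p F)
    (hH : InL μ p H) {A : Set X} (hA : MeasurableSet A) :
    ∀ᵐ x ∂μ, T (A.indicator F) x = 0 ∨ T (Aᶜ.indicator H) x = 0 := by
  rw [hT.disj hp hp2 (hF.indicator hp hA) (hH.indicator hp hA.compl)]
  refine ae_of_all _ fun x => ?_
  by_cases h : x ∈ A <;> simp [h]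

lemma th_compl (hT : IsoOp μ p T) (hp : 0 < p) (hp2 : p ≠ 2) {h : X → ℂ} (hh : InL μ p h)
    (hh0 : ∀ x, h x ≠ 0) {A : Set X} (hA : MeasurableSet A) :
    ∀ᵐ x ∂μ, (x ∈ th T h Aᶜ ↔ x ∉ th T h A) := by
  filter_upwards [hT.Th_ne hp hp2 hh hh0, hT.split hp hh hA, hT.disj_ind hp hp2 hh hh hA]
    with x h1 h2 h3
  simp only [th, Set.mem_setOf_eq, not_not]
  rw [h2] at h1
  constructor
  · intro h; exact h3.resolve_right h
  · intro h h'; simp [h, h'] at h1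

lemma th_mul (hT : IsoOp μ p T) (hp : 0 < p) (hp2 : p ≠ 2) {h : X → ℂ} (hh : InL μ p h)
    (hh0 : ∀ x, h x ≠ 0) {A : Set X} (hA : MeasurableSet A) {F : X → ℂ} (hF : InL μ p F) :
    ∀ᵐ x ∂μ, T (A.indicator F) x = (th T h A).indicator (T F) x := by
  filter_upwards [hT.th_compl hp hp2 hh hh0 hA, hT.split hp hF hA,
    hT.disj_ind hp hp2 hh hF hA, hT.disj_ind hp hp2 hF hh hA] with x h1 h2 h3 h4
  by_cases hx : x ∈ th T h A
  · rw [Set.indicator_of_mem hx, h2]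
    have : T (Aᶜ.indicator F) x = 0 := h3.resolve_left hx
    simp [this]
  · rw [Set.indicator_of_notMem hx]
    exact h4.resolve_right (h1.2 hx)

lemma th_meas (hT : IsoOp μ p T) (hp : 0 < p) {h : X → ℂ} (hh : InL μ p h) {A : Set X}
    (hA : MeasurableSet A) : MeasurableSet (th T h A) :=
  ((hT.mem _ (hh.indicator hp hA)).1 (measurableSet_singleton 0)).compl

lemma th_iUnion (hT : IsoOp μ p T) (hp : 0 < p) (hp2 : p ≠ 2) {h : X → ℂ} (hh : InL μ p h)
    (hh0 : ∀ x, h x ≠ 0) {A : ℕ → Set X} (hA : ∀ n, MeasurableSet (A n)) :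
    ∀ᵐ x ∂μ, (x ∈ th T h (⋃ n, A n) ↔ ∃ n, x ∈ th T h (A n)) := by
  have hU : MeasurableSet (⋃ n, A n) := MeasurableSet.iUnion hA
  have h1 : ∀ n, ∀ᵐ x ∂μ, x ∈ th T h (A n) → x ∈ th T h (⋃ n, A n) := by
    intro n
    have := hT.th_mul hp hp2 hh hh0 hU (hh.indicator hp (hA n))
    rw [Set.indicator_indicator, Set.inter_eq_right.2 (Set.subset_iUnion A n)] at this
    filter_upwards [this] with x hx h2
    by_contra hc
    rw [Set.indicator_of_notMem hc] at hx
    exact h2 hx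
  have h2 : ∀ᵐ x ∂μ, x ∉ th T h (⋃ n, A n) \ ⋃ n, th T h (A n) := by
    refine hT.null_of hp hp2 hh hh0
      (fun i : Option ℕ => i.elim ((⋃ n, A n)ᶜ.indicator h) (fun n => (A n).indicator h)) ?_ ?_
      ((hT.th_meas hp hh hU).diff (MeasurableSet.iUnion fun n => hT.th_meas hp hh (hA n))) ?_
    · rintro (_ | n)
      · exact hh.indicator hp hU.compl
      · exact hh.indicator hp (hA n)
    · intro x
      by_cases hx : x ∈ ⋃ n, A n
      · obtain ⟨n, hn⟩ := Set.mem_iUnion.1 hx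
        exact ⟨some n, by simp [hn, hh0]⟩
      · exact ⟨none, by simp only [Option.elim]; rw [Set.indicator_of_mem hx]; exact hh0 x⟩
    · rintro (_ | n)
      · filter_upwards [hT.th_compl hp hp2 hh hh0 hU] with x hx hx2
        by_contra hc
        exact hx.1 hc hx2.1
      · refine ae_of_all _ fun x hx => ?_
        by_contra hc
        exact hx.2 (Set.mem_iUnion.2 ⟨n, hc⟩)
  filter_upwards [ae_all_iff.2 h1, h2] with x h1 h2
  constructor
  · intro hx
    by_contra hc
    exact h2 ⟨hx, by simpa using hc⟩
  · rintro ⟨n, hn⟩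
    exact h1 n hn

lemma th_empty (hT : IsoOp μ p T) (hp : 0 < p) {h : X → ℂ} (hh : InL μ p h) :
    ∀ᵐ x ∂μ, x ∉ th T h ∅ := by
  have : ∀ᵐ x ∂μ, T ((∅ : Set X).indicator h) x = 0 := by
    rw [hT.eq_zero_iff hp (hh.indicator hp MeasurableSet.empty)]
    simp
  filter_upwards [this] with x hx h2
  exact h2 hx

lemma exists_point (hT : IsoOp μ p T) (hp : 0 < p) (hp2 : p ≠ 2) [StandardBorelSpace X]
    {h : X → ℂ} (hh : InL μ p h) (hh0 : ∀ x, h x ≠ 0) :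
    ∃ τ : X → X, Measurable τ ∧ ∀ A, MeasurableSet A → ∀ᵐ x ∂μ, (τ x ∈ A ↔ x ∈ th T h A) := by
  classical
  rcases isEmpty_or_nonempty X with hX | hX
  · refine ⟨id, measurable_id, fun A hA => ?_⟩
    exact ae_of_all _ fun x => (hX.false x).elim
  set ι := MeasurableSpace.mapNatBool X with hι
  have hιm : Measurable ι := MeasurableSpace.measurable_mapNatBool X
  have hιe : MeasurableEmbedding ι :=
    hιm.measurableEmbedding (MeasurableSpace.injective_mapNatBool X)
  let A : ℕ → Set X := fun n => ι ⁻¹' {y | y n = true}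
  have hC0 : ∀ n, MeasurableSet {y : ℕ → Bool | y n = true} := fun n =>
    measurableSet_eq_fun (measurable_pi_apply n) measurable_const
  have hA : ∀ n, MeasurableSet (A n) := fun n => hιm (hC0 n)
  let r : X → ℕ → Bool := fun x n => decide (x ∈ th T h (A n))
  have hr : Measurable r := by
    refine measurable_pi_iff.2 fun n => measurable_to_bool ?_
    have : (fun x => r x n) ⁻¹' {true} = th T h (A n) := by
      ext x; simp [r]
    rw [this]
    exact hT.th_meas hp hh (hA n)
  obtain ⟨inv, hinv, hinv2⟩ := hιe.exists_measurable_extend (g := id) measurable_id (fun _ => hX)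
  let m' : MeasurableSpace (ℕ → Bool) :=
    { MeasurableSet' := fun C => MeasurableSet C ∧ ∀ᵐ x ∂μ, (r x ∈ C ↔ x ∈ th T h (ι ⁻¹' C))
      measurableSet_empty := by
        refine ⟨MeasurableSet.empty, ?_⟩
        filter_upwards [hT.th_empty hp hh] with x hx
        simpa using hx
      measurableSet_compl := by
        rintro C ⟨hC, h1⟩
        refine ⟨hC.compl, ?_⟩
        filter_upwards [h1, hT.th_compl hp hp2 hh hh0 (hιm hC)] with x hx hx2
        rw [Set.preimage_compl, hx2, ← hx]
        rfl
      measurableSet_iUnion := by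
        intro C hC
        refine ⟨MeasurableSet.iUnion fun n => (hC n).1, ?_⟩
        filter_upwards [ae_all_iff.2 fun n => (hC n).2,
          hT.th_iUnion hp hp2 hh hh0 (fun n => hιm (hC n).1)] with x hx hx2
        rw [Set.preimage_iUnion, hx2]
        simp [hx] }
  have hle : (MeasurableSpace.pi : MeasurableSpace (ℕ → Bool)) ≤ m' := by
    refine iSup_le fun n => ?_
    rw [← measurable_iff_comap_le]
    refine @measurable_to_bool _ m' _ ?_
    refine ⟨hC0 n, ae_of_all _ fun x => ?_⟩
    show r x n = true ↔ _
    simp [r]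
    rfl
  refine ⟨fun x => inv (r x), hinv.comp hr, fun B hB => ?_⟩
  have h1 := (hle _ (hinv hB)).2
  have e : ι ⁻¹' (inv ⁻¹' B) = B := by
    rw [← Set.preimage_comp, hinv2]; rfl
  rw [e] at h1
  exact h1

lemma th_surj (hT : IsoOp μ p T) (hp : 0 < p) (hp2 : p ≠ 2)
    {h : X → ℂ} (hh : InL μ p h) (hh0 : ∀ x, h x ≠ 0) {B : Set X} (hB : MeasurableSet B) :
    ∃ A, MeasurableSet A ∧ ∀ᵐ x ∂μ, (x ∈ th T h A ↔ x ∈ B) := by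
  obtain ⟨F, hF, hTF⟩ := hT.surj _ ((hT.mem h hh).indicator hp hB)
  obtain ⟨F', hF', hTF'⟩ := hT.surj _ ((hT.mem h hh).indicator hp hB.compl)
  have hd : ∀ᵐ x ∂μ, F x = 0 ∨ F' x = 0 := by
    rw [← hT.disj hp hp2 hF hF']
    filter_upwards [hTF, hTF'] with x h1 h2
    rw [h1, h2]
    by_cases hx : x ∈ B <;> simp [hx]
  have hs : ∀ᵐ x ∂μ, (F x + F' x) - h x = 0 := by
    rw [← hT.eq_zero_iff hp ((hF.add hp hF').sub hp hh)]
    filter_upwards [hT.sub hp (hF.add hp hF') hh, hT.add F F' hF hF', hTF, hTF'] with x h1 h2 h3 h4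
    rw [h1, h2, h3, h4]
    by_cases hx : x ∈ B <;> simp [hx]
  have hA : MeasurableSet {x | F x ≠ 0} := (hF.1 (measurableSet_singleton 0)).compl
  refine ⟨{x | F x ≠ 0}, hA, ?_⟩
  have he : {x | F x ≠ 0}.indicator h =ᵐ[μ] F := by
    filter_upwards [hd, hs] with x h1 h2
    by_cases hx : F x = 0
    · simp [hx]
    · rw [Set.indicator_of_mem (by exact hx)]
      rw [h1.resolve_left hx] at h2
      simp at h2
      exact (sub_eq_zero.1 h2).symm
  filter_upwards [hT.congr _ _ (hh.indicator hp hA) hF he, hTF, hT.Th_ne hp hp2 hh hh0]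
    with x h1 h2 h3
  simp only [th, Set.mem_setOf_eq]
  rw [h1, h2]
  by_cases hx : x ∈ B <;> simp [hx, h3]

end IsoOp
end lamperti


section lamperti2
open Filter Topology

variable {X : Type*} [MeasurableSpace X] {μ : Measure X} {p : ℝ}

/-- Lamperti data for an operator. -/
structure LampData (μ : Measure X) (p : ℝ) (T : (X → ℂ) → (X → ℂ)) where
  τ : X → X
  lam : X → ℝ
  a : X → ℂ
  b : X → ℂ
  hτ : Measurable τ
  hlam : Measurable lam
  ha : Measurable a
  hb : Measurable b
  lam_pos : ∀ x, 0 < lam x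
  na : ∀ x, ‖a x‖ = 1
  nb : ∀ x, ‖b x‖ = 1
  orth : ∀ x, (a x).re * (b x).re + (a x).im * (b x).im = 0
  hmap : ∀ ψ : X → ℝ≥0∞, Measurable ψ →
    ∫⁻ x, ENNReal.ofReal (lam x) ^ p * ψ (τ x) ∂μ = ∫⁻ x, ψ x ∂μ
  repr : ∀ F, InL μ p F → ∀ᵐ x ∂μ,
    T F x = lam x • ((F (τ x)).re • a x + (F (τ x)).im • b x)

lemma exists_posL (μ : Measure X) [SigmaFinite μ] (hp : 0 < p) :
    ∃ h : X → ℝ, Measurable h ∧ (∀ x, 0 < h x) ∧ InL μ p (fun x => (h x : ℂ)) := by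
  obtain ⟨g, hg0, hgm, hg⟩ := exists_pos_lintegral_lt_of_sigmaFinite μ (ε := 1) one_ne_zero
  refine ⟨fun x => ((g x : ℝ)) ^ (1 / p), by fun_prop, fun x => ?_, by fun_prop, ?_⟩
  · exact Real.rpow_pos_of_pos (by exact_mod_cast hg0 x) _
  · unfold pInt
    refine lt_of_le_of_lt (le_of_eq ?_) (hg.trans one_lt_top)
    refine lintegral_congr fun x => ?_
    have hx : (0 : ℝ) ≤ g x := (g x).2
    rw [← ofReal_norm, Complex.norm_real, Real.norm_of_nonneg (by positivity),
      ENNReal.ofReal_rpow_of_nonneg (by positivity) hp.le, ← Real.rpow_mul hx,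
      one_div_mul_cancel hp.ne', Real.rpow_one, ENNReal.ofReal_coe_nnreal]

namespace IsoOp
variable {T : (X → ℂ) → (X → ℂ)}

lemma lint_T (hT : IsoOp μ p T) (hp : 0 < p) (hp2 : p ≠ 2)
    {h : X → ℂ} (hh : InL μ p h) (hh0 : ∀ x, h x ≠ 0) {τ : X → X} (hτ : Measurable τ)
    (hτA : ∀ A, MeasurableSet A → ∀ᵐ x ∂μ, (τ x ∈ A ↔ x ∈ th T h A))
    {F : X → ℂ} (hF : InL μ p F) {ψ : X → ℝ≥0∞} (hψ : Measurable ψ) :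
    ∫⁻ x, ‖T F x‖ₑ ^ p * ψ (τ x) ∂μ = ∫⁻ x, ‖F x‖ₑ ^ p * ψ x ∂μ := by
  have hTF := hT.mem F hF
  have hm1 : Measurable fun x => ‖T F x‖ₑ ^ p := by have := hTF.1; fun_prop
  have hm2 : Measurable fun x => ‖F x‖ₑ ^ p := by have := hF.1; fun_prop
  have key : Measure.map τ (μ.withDensity fun x => ‖T F x‖ₑ ^ p)
      = μ.withDensity fun x => ‖F x‖ₑ ^ p := by
    ext A hA
    rw [Measure.map_apply hτ hA, withDensity_apply _ (hτ hA), withDensity_apply _ hA,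
      ← lintegral_indicator (hτ hA), ← lintegral_indicator hA]
    have h1 := hT.iso _ (hF.indicator hp hA)
    unfold pInt at h1
    have e2 : ∫⁻ x, A.indicator (fun x => ‖F x‖ₑ ^ p) x ∂μ = ∫⁻ x, ‖A.indicator F x‖ₑ ^ p ∂μ := by
      refine lintegral_congr fun x => ?_
      by_cases hx : x ∈ A <;> simp [hx, hp]
    rw [e2, ← h1]
    refine lintegral_congr_ae ?_
    filter_upwards [hτA A hA, hT.th_mul hp hp2 hh hh0 hA hF] with x h2 h3
    rw [h3]
    by_cases hx : τ x ∈ A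
    · rw [Set.indicator_of_mem (h2.1 hx), Set.indicator_of_mem (by exact hx)]
    · rw [Set.indicator_of_notMem (fun h => hx (h2.2 h)), Set.indicator_of_notMem (by exact hx)]
      simp [hp]
  have := congrArg (fun m => ∫⁻ x, ψ x ∂m) key
  rw [lintegral_map hψ hτ, lintegral_withDensity_eq_lintegral_mul _ hm1 (show Measurable fun x => ψ (τ x) from hψ.comp hτ),
    lintegral_withDensity_eq_lintegral_mul _ hm2 hψ] at this
  exact this

lemma lint_lam (hT : IsoOp μ p T) (hp : 0 < p) (hp2 : p ≠ 2)
    {h : X → ℂ} (hh : InL μ p h) (hh0 : ∀ x, h x ≠ 0) {τ : X → X} (hτ : Measurable τ)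
    (hτA : ∀ A, MeasurableSet A → ∀ᵐ x ∂μ, (τ x ∈ A ↔ x ∈ th T h A))
    {ψ : X → ℝ≥0∞} (hψ : Measurable ψ) :
    ∫⁻ x, ENNReal.ofReal (‖T h x‖ / ‖h (τ x)‖) ^ p * ψ (τ x) ∂μ = ∫⁻ x, ψ x ∂μ := by
  have hhm := hh.1
  have h1 := hT.lint_T hp hp2 hh hh0 hτ hτA hh (ψ := fun x => (‖h x‖ₑ ^ p)⁻¹ * ψ x) (by fun_prop)
  have hn : ∀ x, ‖h x‖ₑ ^ p ≠ 0 := fun x => by simp [hh0 x, hp.le, not_lt.2 hp.le]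
  have hn2 : ∀ x, ‖h x‖ₑ ^ p ≠ ⊤ := fun x => ENNReal.rpow_ne_top_of_nonneg hp.le enorm_ne_top
  simp_rw [← mul_assoc] at h1
  simp_rw [ENNReal.mul_inv_cancel (hn _) (hn2 _), one_mul] at h1
  rw [← h1]
  refine lintegral_congr fun x => ?_
  rw [ENNReal.ofReal_div_of_pos (by simpa using hh0 _), ofReal_norm, ofReal_norm,
    ENNReal.div_rpow_of_nonneg _ _ hp.le]
  rfl

lemma norm_T (hT : IsoOp μ p T) (hp : 0 < p) (hp2 : p ≠ 2) [SigmaFinite μ]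
    {h : X → ℂ} (hh : InL μ p h) (hh0 : ∀ x, h x ≠ 0) {τ : X → X} (hτ : Measurable τ)
    (hτA : ∀ A, MeasurableSet A → ∀ᵐ x ∂μ, (τ x ∈ A ↔ x ∈ th T h A))
    {F : X → ℂ} (hF : InL μ p F) :
    ∀ᵐ x ∂μ, ‖T F x‖ = ‖T h x‖ / ‖h (τ x)‖ * ‖F (τ x)‖ := by
  have hhm := hh.1
  have hThm := (hT.mem h hh).1
  have hFm := hF.1
  have hTFm := (hT.mem F hF).1
  have key : (fun x => ‖T F x‖ₑ ^ p) =ᵐ[μ]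
      fun x => ENNReal.ofReal (‖T h x‖ / ‖h (τ x)‖) ^ p * ‖F (τ x)‖ₑ ^ p := by
    refine ae_eq_of_forall_setLIntegral_eq_of_sigmaFinite (by fun_prop) (by fun_prop) ?_
    intro B hB _
    obtain ⟨A, hA, hAB⟩ := hT.th_surj hp hp2 hh hh0 hB
    have h1 := hT.lint_T hp hp2 hh hh0 hτ hτA hF (ψ := A.indicator 1) (measurable_one.indicator hA)
    have h2 := hT.lint_lam hp hp2 hh hh0 hτ hτA (ψ := fun x => ‖F x‖ₑ ^ p * A.indicator 1 x)
      (by have := (measurable_one (α := ℝ≥0∞) (β := X)).indicator hA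
          exact Measurable.mul (by fun_prop) this)
    rw [← h2] at h1
    rw [← lintegral_indicator hB, ← lintegral_indicator hB]
    have aux : ∀ᵐ x ∂μ, (A.indicator (1 : X → ℝ≥0∞) (τ x) = B.indicator 1 x) := by
      filter_upwards [hτA A hA, hAB] with x h3 h4
      have : τ x ∈ A ↔ x ∈ B := h3.trans h4
      by_cases hx : x ∈ B
      · rw [Set.indicator_of_mem hx, Set.indicator_of_mem (this.2 hx)]; rfl
      · rw [Set.indicator_of_notMem hx, Set.indicator_of_notMem (fun h => hx (this.1 h))]
    refine Eq.trans ?_ (h1.trans ?_)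
    · refine lintegral_congr_ae ?_
      filter_upwards [aux] with x hx
      rw [hx]
      by_cases hx : x ∈ B <;> simp [hx]
    · refine lintegral_congr_ae ?_
      filter_upwards [aux] with x hx
      rw [hx]
      by_cases hx : x ∈ B <;> simp [hx]
  filter_upwards [key] with x hx
  rw [← ENNReal.mul_rpow_of_nonneg _ _ hp.le] at hx
  have h3 := (ENNReal.rpow_left_injective hp.ne') hx
  have h4 := congrArg ENNReal.toReal h3
  simpa [ENNReal.toReal_mul, ENNReal.toReal_ofReal (show 0 ≤ ‖T h x‖ / ‖h (τ x)‖ by positivity)]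
    using h4

lemma iso_algebra {A B : ℂ} {n : ℝ} (hn : 0 < n)
    (h : ∀ u : ℂ, ‖u.re • A + u.im • B‖ = n * ‖u‖) :
    ‖A‖ = n ∧ ‖B‖ = n ∧ A.re * B.re + A.im * B.im = 0 := by
  have h1 := h 1
  have h2 := h Complex.I
  have h3 := h (1 + Complex.I)
  simp at h1 h2 h3
  refine ⟨h1, h2, ?_⟩
  have e1 : ‖A‖ ^ 2 = n ^ 2 := by rw [h1]
  have e2 : ‖B‖ ^ 2 = n ^ 2 := by rw [h2]
  have e3 : ‖A + B‖ ^ 2 = n ^ 2 * ‖1 + Complex.I‖ ^ 2 := by rw [h3]; ring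
  rw [← Complex.normSq_eq_norm_sq, Complex.normSq_apply] at e1 e2 e3
  rw [← Complex.normSq_eq_norm_sq, Complex.normSq_apply] at e3
  simp at e3
  nlinarith

lemma exists_lamp (hT : IsoOp μ p T) (hp : 0 < p) (hp2 : p ≠ 2) [SigmaFinite μ]
    [StandardBorelSpace X] : Nonempty (LampData μ p T) := by
  obtain ⟨h0, h0m, h0p, hh⟩ := exists_posL μ hp
  set h : X → ℂ := fun x => (h0 x : ℂ) with hdef
  have hh0 : ∀ x, h x ≠ 0 := fun x => by simp [hdef, (h0p x).ne']
  have hnh : ∀ x, ‖h x‖ = h0 x := fun x => by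
    simp [hdef, abs_of_pos (h0p x)]
  obtain ⟨τ, hτ, hτA⟩ := hT.exists_point hp hp2 hh hh0
  have hih : InL μ p (fun x => Complex.I * h x) :=
    hh.mono hp (by have := hh.1; fun_prop) fun x => by simp
  have hThm := (hT.mem h hh).1
  have hTim := (hT.mem _ hih).1
  have hlin : ∀ F, InL μ p F → ∀ u : ℂ, ∀ᵐ x ∂μ,
      ‖T F x - (u.re • T h x + u.im • T (fun x => Complex.I * h x) x)‖
        = ‖T h x‖ / h0 (τ x) * ‖F (τ x) - u * h0 (τ x)‖ := by
    intro F hF u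
    have i1 := hh.smul hp u.re
    have i2 := hih.smul hp u.im
    have i3 := i1.add hp i2
    filter_upwards [hT.norm_T hp hp2 hh hh0 hτ hτA (hF.sub hp i3), hT.sub hp hF i3,
      hT.add _ _ i1 i2, hT.smul u.re _ hh, hT.smul u.im _ hih] with x h1 h2 h3 h4 h5
    rw [← h4, ← h5, ← h3, ← h2, h1, hnh]
    congr 2
    simp only [hdef, Complex.real_smul]
    conv_rhs => rw [← Complex.re_add_im u]
    ring
  have hall : ∀ F, InL μ p F → ∀ᵐ x ∂μ, ∀ u : ℂ, 
      ‖T F x - (u.re • T h x + u.im • T (fun x => Complex.I * h x) x)‖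
        = ‖T h x‖ / h0 (τ x) * ‖F (τ x) - u * h0 (τ x)‖ := by
    intro F hF
    have := ae_all_iff.2 fun n : ℕ => hlin F hF (TopologicalSpace.denseSeq ℂ n)
    filter_upwards [this] with x hx
    have hd := TopologicalSpace.denseRange_denseSeq ℂ
    have := hd.equalizer (g := fun u : ℂ => 
      ‖T F x - (u.re • T h x + u.im • T (fun x => Complex.I * h x) x)‖)
      (h := fun u : ℂ => ‖T h x‖ / h0 (τ x) * ‖F (τ x) - u * h0 (τ x)‖)
      (by fun_prop) (by fun_prop) (by ext n; exact hx n)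
    exact fun u => congrFun this u
  have h00 : InL μ p (fun _ => (0 : ℂ)) := hh.mono hp (by fun_prop) fun x => by simp
  have hT0 : ∀ᵐ x ∂μ, T (fun _ => (0 : ℂ)) x = 0 := (hT.eq_zero_iff hp h00).2 (by simp)
  have hgood : ∀ᵐ x ∂μ, 0 < ‖T h x‖ ∧ ‖T (fun x => Complex.I * h x) x‖ = ‖T h x‖ ∧
      (T h x).re * (T (fun x => Complex.I * h x) x).re
        + (T h x).im * (T (fun x => Complex.I * h x) x).im = 0 := by
    filter_upwards [hall _ h00, hT.Th_ne hp hp2 hh hh0, hT0] with x h1 h2 h3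
    have hn : 0 < ‖T h x‖ := norm_pos_iff.2 h2
    refine ⟨hn, ?_⟩
    have := iso_algebra (A := T h x) (B := T (fun x => Complex.I * h x) x) hn (fun u => by
      have := h1 u
      rw [h3, zero_sub, norm_neg, zero_sub, norm_neg, norm_mul, Complex.norm_real,
        Real.norm_of_nonneg (h0p _).le] at this
      rw [this]
      have := (h0p (τ x)).ne'
      field_simp)
    exact this.2
  set TI := T (fun x => Complex.I * h x) with hTI
  let Gd : Set X := {x | 0 < ‖T h x‖ ∧ ‖TI x‖ = ‖T h x‖ ∧
      (T h x).re * (TI x).re + (T h x).im * (TI x).im = 0}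
  have hGd : MeasurableSet Gd := by
    have m1 : MeasurableSet {x | 0 < ‖T h x‖} := measurableSet_lt (by fun_prop) (by fun_prop)
    have m2 : MeasurableSet {x | ‖TI x‖ = ‖T h x‖} :=
      measurableSet_eq_fun (by fun_prop) (by fun_prop)
    have m3 : MeasurableSet {x | (T h x).re * (TI x).re + (T h x).im * (TI x).im = 0} :=
      measurableSet_eq_fun (by fun_prop) (by fun_prop)
    exact m1.inter (m2.inter m3)
  classical
  refine ⟨{ τ := τ
            lam := fun x => if x ∈ Gd then ‖T h x‖ / h0 (τ x) else 1
            a := fun x => if x ∈ Gd then (‖T h x‖)⁻¹ • T h x else 1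
            b := fun x => if x ∈ Gd then (‖T h x‖)⁻¹ • TI x else Complex.I
            hτ := hτ
            hlam := Measurable.ite hGd (by fun_prop) (by fun_prop)
            ha := Measurable.ite hGd (by fun_prop) (by fun_prop)
            hb := Measurable.ite hGd (by fun_prop) (by fun_prop)
            lam_pos := ?_
            na := ?_
            nb := ?_
            orth := ?_
            hmap := ?_
            repr := ?_ }⟩
  · intro x
    split_ifs with hx
    · exact div_pos hx.1 (h0p _)
    · exact one_pos
  · intro x
    split_ifs with hx
    · rw [norm_smul, norm_inv, norm_norm, inv_mul_cancel₀ hx.1.ne']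
    · simp
  · intro x
    split_ifs with hx
    · rw [norm_smul, norm_inv, norm_norm, hx.2.1, inv_mul_cancel₀ hx.1.ne']
    · simp
  · intro x
    split_ifs with hx
    · have := hx.2.2
      simp only [Complex.real_smul, Complex.re_ofReal_mul, Complex.im_ofReal_mul]
      linear_combination (‖T h x‖)⁻¹ * (‖T h x‖)⁻¹ * this
    · simp
  · intro ψ hψ
    rw [← hT.lint_lam hp hp2 hh hh0 hτ hτA hψ]
    refine lintegral_congr_ae ?_
    filter_upwards [hgood] with x hx
    have hx' : x ∈ Gd := hx
    rw [if_pos hx', hnh]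
  · intro F hF
    filter_upwards [hgood, hall F hF] with x hx h1
    have hx' : x ∈ Gd := hx
    rw [if_pos hx', if_pos hx', if_pos hx']
    have h2 := h1 (F (τ x) / h0 (τ x))
    have hc : (h0 (τ x) : ℂ) ≠ 0 := by exact_mod_cast (h0p _).ne'
    rw [div_mul_cancel₀ _ hc, sub_self, norm_zero, mul_zero, norm_eq_zero, sub_eq_zero] at h2
    rw [h2, Complex.div_ofReal_re, Complex.div_ofReal_im]
    simp only [Complex.real_smul]
    push_cast
    have hn : ((‖T h x‖ : ℝ) : ℂ) ≠ 0 := by exact_mod_cast hx.1.ne'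
    field_simp

end IsoOp
end lamperti2


section fnact
open Filter Topology

variable {X : Type*} [MeasurableSpace X] 

/-- An affine isometric action described on measurable representatives. -/
structure FnAct (G : Type*) [Group G] [TopologicalSpace G] (μ : Measure X) (p : ℝ) where
  fn : G → (X → ℂ) → (X → ℂ)
  mem : ∀ g F, InL μ p F → InL μ p (fn g F)
  congr : ∀ g F H, InL μ p F → InL μ p H → F =ᵐ[μ] H → fn g F =ᵐ[μ] fn g H
  iso : ∀ g F H, InL μ p F → InL μ p H →
    pInt μ p (fun x => fn g F x - fn g H x) = pInt μ p (fun x => F x - H x)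
  one : ∀ F, InL μ p F → fn 1 F =ᵐ[μ] F
  mul : ∀ g h F, InL μ p F → fn (g * h) F =ᵐ[μ] fn g (fn h F)
  affine : ∀ g (t : ℝ) F H, InL μ p F → InL μ p H →
    ∀ᵐ x ∂μ, fn g (fun x => t • F x + (1 - t) • H x) x = t • fn g F x + (1 - t) • fn g H x
  cont : ∀ F, InL μ p F → Tendsto (fun g => pInt μ p (fun x => fn g F x - F x)) (𝓝 1) (𝓝 0)
  proper : ∀ R : ℝ≥0∞, R ≠ ⊤ → IsCompact (closure {g | pInt μ p (fn g (fun _ => 0)) ≤ R})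

variable {G : Type*} [Group G] [TopologicalSpace G] {μ : Measure X} {p : ℝ}

lemma InL.memLp (hp : 0 < p) {F : X → ℂ} (hF : InL μ p F) : MemLp F (ENNReal.ofReal p) μ :=
  (memLp_iff_pInt hp hF.1.aestronglyMeasurable).2 hF.2

lemma InL.zero (hp : 0 < p) : InL μ p (fun _ : X => (0 : ℂ)) := by
  refine ⟨measurable_const, ?_⟩
  simp [pInt, hp]

lemma Lp_InL (hp : 0 < p) (f : Lp ℂ (ENNReal.ofReal p) μ) : InL μ p f :=
  ⟨(Lp.stronglyMeasurable f).measurable,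
    (memLp_iff_pInt hp (Lp.memLp f).1).1 (Lp.memLp f)⟩

open Classical in
/-- The representative-level operator. -/
noncomputable def afn (hp : 0 < p) (α : AffineIsometricAction G μ p) (g : G) (F : X → ℂ) : X → ℂ :=
  if h : InL μ p F then (α.act g ((h.memLp hp).toLp F) : X → ℂ) else 0

lemma afn_eq (hp : 0 < p) (α : AffineIsometricAction G μ p) (g : G) {F : X → ℂ}
    (h : InL μ p F) : afn hp α g F = (α.act g ((h.memLp hp).toLp F) : X → ℂ) := by
  unfold afn; rw [dif_pos h]

lemma pPow_sub_eq (hp : 0 < p) (f f' : Lp ℂ (ENNReal.ofReal p) μ) :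
    pPow μ p ((f : X →ₘ[μ] ℂ) - (f' : X →ₘ[μ] ℂ)) = pInt μ p (fun x => f x - f' x) := by
  rw [pPow_eq_pInt]
  refine pInt_congr ?_
  filter_upwards [AEEqFun.coeFn_sub (f : X →ₘ[μ] ℂ) (f' : X →ₘ[μ] ℂ)] with x hx
  rw [hx]; rfl

lemma toLp_afn (hp : 0 < p) (α : AffineIsometricAction G μ p) (g : G) {F : X → ℂ}
    (h : InL μ p F) (h' : InL μ p (afn hp α g F)) :
    (h'.memLp hp).toLp (afn hp α g F) = α.act g ((h.memLp hp).toLp F) := by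
  apply Lp.ext
  refine (MemLp.coeFn_toLp _).trans ?_
  rw [afn_eq hp α g h]

/-- The action on representatives. -/
noncomputable def AffineIsometricAction.toFnAct [IsTopologicalGroup G] (hp : 0 < p)
    (α : AffineIsometricAction G μ p)
    (hα : α.MetricallyProper) : FnAct G μ p where
  fn := afn hp α
  mem g F hF := by rw [afn_eq hp α g hF]; exact Lp_InL hp _
  congr g F H hF hH hFH := by
    rw [afn_eq hp α g hF, afn_eq hp α g hH, (MemLp.toLp_eq_toLp_iff (hF.memLp hp) (hH.memLp hp)).2 hFH]
  iso g F H hF hH := by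
    rw [afn_eq hp α g hF, afn_eq hp α g hH, ← pPow_sub_eq hp, α.isometry, pPow_sub_eq hp]
    refine pInt_congr ?_
    filter_upwards [(hF.memLp hp).coeFn_toLp, (hH.memLp hp).coeFn_toLp] with x h1 h2
    rw [h1, h2]
  one F hF := by
    rw [afn_eq hp α 1 hF, α.act_one]
    exact (hF.memLp hp).coeFn_toLp
  mul g h F hF := by
    have h' : InL μ p (afn hp α h F) := by rw [afn_eq hp α h hF]; exact Lp_InL hp _
    rw [afn_eq hp α _ hF, α.act_mul, afn_eq hp α g h', toLp_afn hp α h hF h']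
  affine g t F H hF hH := by
    have h' : InL μ p (fun x => t • F x + (1 - t) • H x) := (hF.smul hp t).add hp (hH.smul hp (1 - t))
    rw [afn_eq hp α _ hF, afn_eq hp α _ hH, afn_eq hp α _ h']
    have e : (h'.memLp hp).toLp _ = t • (hF.memLp hp).toLp F + (1 - t) • (hH.memLp hp).toLp H := by
      rw [← MemLp.toLp_const_smul, ← MemLp.toLp_const_smul, ← MemLp.toLp_add]
      rfl
    rw [e, α.affine]
    filter_upwards [Lp.coeFn_add (t • α.act g ((hF.memLp hp).toLp F))
        ((1 - t) • α.act g ((hH.memLp hp).toLp H)),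
      Lp.coeFn_smul t (α.act g ((hF.memLp hp).toLp F)),
      Lp.coeFn_smul (1 - t) (α.act g ((hH.memLp hp).toLp H))] with x h1 h2 h3
    rw [h1, Pi.add_apply, h2, h3]
    rfl
  cont F hF := by
    have := α.continuous ((hF.memLp hp).toLp F) 1
    refine this.congr fun g => ?_
    rw [pPow_sub_eq hp, α.act_one, afn_eq hp α _ hF]
    refine pInt_congr ?_
    filter_upwards [(hF.memLp hp).coeFn_toLp] with x h1
    rw [h1]
  proper R hR := by
    have := hα R hR
    have e : ∀ g, pInt μ p (afn hp α g (fun _ => 0)) = pPow μ p ((α.act g 0 : X →ₘ[μ] ℂ)) := by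
      intro g
      rw [afn_eq hp α g (InL.zero hp), pPow_eq_pInt]
      have : ((InL.zero (μ := μ) hp).memLp hp).toLp (fun _ : X => (0 : ℂ)) = 0 := MemLp.toLp_zero _
      rw [this]
    simpa only [e] using this

namespace FnAct
variable (A : FnAct G μ p)

/-- The translation part. -/
def c (g : G) : X → ℂ := A.fn g (fun _ => 0)

/-- The linear part. -/
def U (g : G) (F : X → ℂ) : X → ℂ := fun x => A.fn g F x - A.c g x

lemma c_mem (hp : 0 < p) (g : G) : InL μ p (A.c g) := A.mem g _ (InL.zero hp)

lemma U_smul (hp : 0 < p) (g : G) (t : ℝ) {F : X → ℂ} (hF : InL μ p F) :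
    ∀ᵐ x ∂μ, A.U g (fun x => t • F x) x = t • A.U g F x := by
  have := A.affine g t F _ hF (InL.zero hp)
  simp only [smul_zero, add_zero] at this
  filter_upwards [this] with x hx
  simp only [U, c]
  rw [hx]
  module

lemma U_isoOp (hp : 0 < p) (g : G) : IsoOp μ p (A.U g) where
  mem F hF := (A.mem g F hF).sub hp (A.c_mem hp g)
  congr F H hF hH hFH := by
    filter_upwards [A.congr g F H hF hH hFH] with x hx
    simp [U, hx]
  smul t F hF := A.U_smul hp g t hF
  add F H hF hH := by
    have h1 := A.affine g (1 / 2) _ _ (hF.smul hp 2) (hH.smul hp 2)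
    have e : (fun x => (1 / 2 : ℝ) • (2 : ℝ) • F x + (1 - 1 / 2 : ℝ) • (2 : ℝ) • H x)
        = fun x => F x + H x := by ext x; module
    rw [e] at h1
    filter_upwards [h1, A.U_smul hp g 2 hF, A.U_smul hp g 2 hH] with x h1 h2 h3
    simp only [U] at h2 h3 ⊢
    rw [h1, sub_eq_iff_eq_add.1 h2, sub_eq_iff_eq_add.1 h3]
    module
  iso F hF := by
    have := A.iso g F _ hF (InL.zero hp)
    simp only [sub_zero] at this
    exact this
  surj F hF := by
    have h1 : InL μ p (fun x => F x + A.c g x) := hF.add hp (A.c_mem hp g)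
    refine ⟨A.fn g⁻¹ (fun x => F x + A.c g x), A.mem _ _ h1, ?_⟩
    have h2 := A.mul g g⁻¹ _ h1
    rw [mul_inv_cancel] at h2
    filter_upwards [h2, A.one _ h1] with x h2 h3
    simp only [U]
    rw [← h2, h3]
    simp

end FnAct
end fnact


section keyint
open Filter Topology

/-- Coordinates with respect to `(a, b)`. -/
def Rinv (a b z : ℂ) : ℂ :=
  ⟨a.re * z.re + a.im * z.im, b.re * z.re + b.im * z.im⟩

/-- The map with columns `(a, b)`. -/
noncomputable def Rab (a b z : ℂ) : ℂ := z.re • a + z.im • b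

lemma cols {a b : ℂ} (na : ‖a‖ = 1) (nb : ‖b‖ = 1) (h : a.re * b.re + a.im * b.im = 0) :
    a.re ^ 2 + b.re ^ 2 = 1 ∧ a.im ^ 2 + b.im ^ 2 = 1 ∧ a.re * a.im + b.re * b.im = 0 := by
  have e1 : a.re ^ 2 + a.im ^ 2 = 1 := by
    have : ‖a‖ ^ 2 = 1 := by rw [na]; norm_num
    rw [← Complex.normSq_eq_norm_sq, Complex.normSq_apply] at this
    linarith
  have e2 : b.re ^ 2 + b.im ^ 2 = 1 := by
    have : ‖b‖ ^ 2 = 1 := by rw [nb]; norm_num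
    rw [← Complex.normSq_eq_norm_sq, Complex.normSq_apply] at this
    linarith
  obtain ⟨t, ht⟩ : ∃ t, t = -b.re * a.im + b.im * a.re := ⟨_, rfl⟩
  have h1 : b.re = -t * a.im := by rw [ht]; linear_combination -b.re * e1 + a.re * h
  have h2 : b.im = t * a.re := by rw [ht]; linear_combination -b.im * e1 + a.im * h
  have h3 : t ^ 2 = 1 := by
    rw [h1, h2] at e2
    linear_combination e2 - t ^ 2 * e1
  rw [h1, h2]
  refine ⟨by linear_combination e1 + a.im ^ 2 * h3, by linear_combination e1 + a.re ^ 2 * h3,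
    by linear_combination (- a.re * a.im) * h3⟩

lemma Rab_Rinv {a b : ℂ} (na : ‖a‖ = 1) (nb : ‖b‖ = 1) (h : a.re * b.re + a.im * b.im = 0) (z : ℂ) :
    Rab a b (Rinv a b z) = z := by
  obtain ⟨h1, h2, h3⟩ := cols na nb h
  apply Complex.ext
  · simp [Rab, Rinv]
    linear_combination z.re * h1 + z.im * h3
  · simp [Rab, Rinv]
    linear_combination z.im * h2 + z.re * h3

lemma norm_Rab {a b : ℂ} (na : ‖a‖ = 1) (nb : ‖b‖ = 1) (h : a.re * b.re + a.im * b.im = 0) (z : ℂ) :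
    ‖Rab a b z‖ = ‖z‖ := by
  have e1 : a.re ^ 2 + a.im ^ 2 = 1 := by
    have : ‖a‖ ^ 2 = 1 := by rw [na]; norm_num
    rw [← Complex.normSq_eq_norm_sq, Complex.normSq_apply] at this
    linarith
  have e2 : b.re ^ 2 + b.im ^ 2 = 1 := by
    have : ‖b‖ ^ 2 = 1 := by rw [nb]; norm_num
    rw [← Complex.normSq_eq_norm_sq, Complex.normSq_apply] at this
    linarith
  rw [← sq_eq_sq₀ (norm_nonneg _) (norm_nonneg _), ← Complex.normSq_eq_norm_sq,
    ← Complex.normSq_eq_norm_sq, Complex.normSq_apply, Complex.normSq_apply]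
  simp [Rab]
  linear_combination z.re ^ 2 * e1 + z.im ^ 2 * e2 + 2 * z.re * z.im * h

lemma norm_Rinv {a b : ℂ} (na : ‖a‖ = 1) (nb : ‖b‖ = 1) (h : a.re * b.re + a.im * b.im = 0) (z : ℂ) :
    ‖Rinv a b z‖ = ‖z‖ := by
  rw [← norm_Rab na nb h, Rab_Rinv na nb h]

lemma Rab_sub (a b z w : ℂ) : Rab a b (z - w) = Rab a b z - Rab a b w := by
  simp only [Rab, Complex.sub_re, Complex.sub_im]; module

lemma Rinv_Rab {a b : ℂ} (na : ‖a‖ = 1) (nb : ‖b‖ = 1) (h : a.re * b.re + a.im * b.im = 0) (z : ℂ) :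
    Rinv a b (Rab a b z) = z := by
  rw [← sub_eq_zero, ← norm_eq_zero, ← norm_Rab na nb h, Rab_sub, Rab_Rinv na nb h, sub_self,
    norm_zero]

lemma lint_scale (r : ℝ) (hr : 0 < r) (v : ℂ) {F : ℂ → ℝ≥0∞} (hF : Measurable F) :
    ∫⁻ z, F (r⁻¹ • (z - v)) = ENNReal.ofReal (r ^ 2) * ∫⁻ z, F z := by
  have h1 : ∫⁻ z : ℂ, F (r⁻¹ • (z - v)) = ∫⁻ z : ℂ, F (r⁻¹ • z) :=
    lintegral_sub_right_eq_self (fun z : ℂ => F (r⁻¹ • z)) v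
  have hm : Measurable fun z : ℂ => r⁻¹ • z := by fun_prop
  rw [h1, ← lintegral_map hF hm, Measure.map_addHaar_smul _ (inv_ne_zero hr.ne'),
    lintegral_smul_measure]
  congr 2
  rw [Complex.finrank_real_complex, abs_of_nonneg (by positivity)]
  simp

lemma lint_aff {a b : ℂ} (na : ‖a‖ = 1) (nb : ‖b‖ = 1) (h : a.re * b.re + a.im * b.im = 0)
    (r : ℝ) (hr : 0 < r) (v : ℂ) {F : ℂ → ℝ≥0∞} (hF : Measurable F) :
    ∫⁻ z, F (Rinv a b (r⁻¹ • (z - v))) = ENNReal.ofReal (r ^ 2) * ∫⁻ z, F z := by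
  let L : ℂ →ₗᵢ[ℝ] ℂ :=
    { toFun := Rinv a b
      map_add' := fun x y => by apply Complex.ext <;> simp [Rinv] <;> ring
      map_smul' := fun t y => by apply Complex.ext <;> simp [Rinv] <;> ring
      norm_map' := norm_Rinv na nb h }
  have hL := (L.toLinearIsometryEquiv rfl).measurePreserving
  have hm : Measurable (Rinv a b) := hL.measurable
  have h1 := lint_scale r hr v (F := fun z => F (Rinv a b z)) (hF.comp hm)
  rw [h1]
  congr 1
  exact hL.lintegral_comp hF

variable {p q : ℝ}

/-- The key constant. -/
noncomputable def keyC (p q : ℝ) : ℝ≥0∞ :=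
  ∫⁻ z : ℂ, ‖‖z - 1‖ ^ ((p - 2) / q) - ‖z‖ ^ ((p - 2) / q)‖ₑ ^ q

lemma keyint (hp : 0 < p) (hpq : p < q) (u v : ℂ) :
    ∫⁻ z : ℂ, ‖‖z - u‖ ^ ((p - 2) / q) - ‖z - v‖ ^ ((p - 2) / q)‖ₑ ^ q
      = keyC p q * ‖u - v‖ₑ ^ p := by
  have hq : 0 < q := hp.trans hpq
  set s := (p - 2) / q with hs
  by_cases hw : u = v
  · subst hw
    simp [hq, hp]
  have hw' : u - v ≠ 0 := sub_ne_zero.2 hw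
  set w := u - v with hwdef
  have hn : 0 < ‖w‖ := norm_pos_iff.2 hw'
  set a : ℂ := (‖w‖ : ℂ)⁻¹ * w with ha
  have hnc : (‖w‖ : ℂ) ≠ 0 := by exact_mod_cast hn.ne'
  have na : ‖a‖ = 1 := by
    rw [ha, norm_mul, norm_inv, Complex.norm_real, norm_norm, inv_mul_cancel₀ hn.ne']
  have nb : ‖Complex.I * a‖ = 1 := by simp [na]
  have hab : a.re * (Complex.I * a).re + a.im * (Complex.I * a).im = 0 := by simp; ring
  have hR : ∀ y, ‖w‖ • Rab a (Complex.I * a) y = w * y := by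
    intro y
    have : Rab a (Complex.I * a) y = a * y := by
      unfold Rab
      conv_rhs => rw [← Complex.re_add_im y]
      simp only [Complex.real_smul]; ring
    rw [this, ha, Complex.real_smul]
    field_simp
  have hF : Measurable fun z : ℂ => ‖‖z - 1‖ ^ s - ‖z‖ ^ s‖ₑ ^ q := by fun_prop
  have h1 := lint_aff na nb hab ‖w‖ hn v hF
  have hpt : ∀ z : ℂ, ‖‖z - u‖ ^ s - ‖z - v‖ ^ s‖ₑ ^ q = ENNReal.ofReal (‖w‖ ^ s) ^ q *
      ‖‖Rinv a (Complex.I * a) (‖w‖⁻¹ • (z - v)) - 1‖ ^ s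
        - ‖Rinv a (Complex.I * a) (‖w‖⁻¹ • (z - v))‖ ^ s‖ₑ ^ q := by
    intro z
    set y := Rinv a (Complex.I * a) (‖w‖⁻¹ • (z - v)) with hy
    have hz : z - v = w * y := by
      rw [← hR, hy, Rab_Rinv na nb hab, smul_inv_smul₀ hn.ne']
    have hz2 : z - u = w * (y - 1) := by
      rw [mul_sub, ← hz, hwdef]; ring
    rw [hz, hz2, norm_mul, norm_mul, Real.mul_rpow hn.le (norm_nonneg _),
      Real.mul_rpow hn.le (norm_nonneg _), ← mul_sub, enorm_mul,
      ENNReal.mul_rpow_of_nonneg _ _ hq.le]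
    congr 2
    rw [← ofReal_norm, Real.norm_of_nonneg (by positivity)]
  simp_rw [hpt]
  rw [lintegral_const_mul _ (by
    have hm : Measurable fun z : ℂ => Rinv a (Complex.I * a) (‖w‖⁻¹ • (z - v)) := by
      have : Continuous fun z : ℂ => Rinv a (Complex.I * a) (‖w‖⁻¹ • (z - v)) := by
        unfold Rinv
        refine Complex.equivRealProdCLM.symm.continuous.comp (Continuous.prodMk ?_ ?_) <;> fun_prop
      exact this.measurable
    exact hF.comp hm), h1]
  show _ = keyC p q * _
  rw [← mul_assoc, mul_comm (keyC p q)]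
  congr 1
  rw [← ofReal_norm w, ENNReal.ofReal_rpow_of_pos (by positivity), ENNReal.ofReal_rpow_of_pos hn,
    ← ENNReal.ofReal_mul (by positivity)]
  congr 1
  rw [← Real.rpow_mul hn.le, ← Real.rpow_natCast, ← Real.rpow_add hn]
  congr 1
  rw [hs]; field_simp; push_cast; ring

lemma ball_fin (hp : 0 < p) (hq : 0 < q) (r : ℝ) :
    ∫⁻ z in Metric.ball (0 : ℂ) r, ‖‖z‖ ^ ((p - 2) / q)‖ₑ ^ q < ⊤ := by
  have := integrableOn_ball_of_norm_le_rpow (μ := (volume : Measure ℂ)) (E := ℂ) (F := ℝ)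
    (f := fun z => ‖z‖ ^ (p - 2)) (C := 1) (α := 2 - p) (r := r)
    (by simp [Complex.finrank_real_complex]) (by simp [Complex.finrank_real_complex, hp])
    (ae_of_all _ fun z => by
      rw [one_mul, neg_sub, Real.norm_of_nonneg (by positivity)])
    (Measurable.aestronglyMeasurable (by fun_prop))
  have h2 := this.2
  unfold HasFiniteIntegral at h2
  refine lt_of_le_of_lt (le_of_eq ?_) h2
  refine lintegral_congr fun z => ?_
  rw [← ofReal_norm, ← ofReal_norm, Real.norm_of_nonneg (by positivity),
    Real.norm_of_nonneg (by positivity), ENNReal.ofReal_rpow_of_nonneg (by positivity) hq.le,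
    ← Real.rpow_mul (norm_nonneg _)]
  congr 2
  field_simp

lemma rpow_diff {s x y : ℝ} (hx : 2 ≤ x) (hy : 0 < y) (hxy : |x - y| ≤ 1) :
    |y ^ s - x ^ s| ≤ |s| * 2 ^ |s - 1| * x ^ (s - 1) := by
  have hx0 : 0 < x := by linarith
  have hb : ∀ t ∈ Set.Icc (x / 2) (2 * x), ‖s * t ^ (s - 1)‖ ≤ |s| * 2 ^ |s - 1| * x ^ (s - 1) := by
    intro t ht
    have ht0 : 0 < t := by linarith [ht.1]
    rw [norm_mul, Real.norm_eq_abs, Real.norm_of_nonneg (by positivity), mul_assoc]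
    refine mul_le_mul_of_nonneg_left ?_ (abs_nonneg s)
    have e : t ^ (s - 1) = (t / x) ^ (s - 1) * x ^ (s - 1) := by
      rw [← Real.mul_rpow (by positivity) hx0.le, div_mul_cancel₀ _ hx0.ne']
    rw [e]
    refine mul_le_mul_of_nonneg_right ?_ (by positivity)
    have h1 : 1 / 2 ≤ t / x := by rw [div_le_div_iff₀ (by norm_num) hx0]; linarith [ht.1]
    have h2 : t / x ≤ 2 := by rw [div_le_iff₀ hx0]; exact ht.2
    rcases le_total 0 (s - 1) with h | h
    · rw [abs_of_nonneg h]
      exact Real.rpow_le_rpow (by positivity) h2 h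
    · rw [abs_of_nonpos h]
      calc (t / x) ^ (s - 1) ≤ (1 / 2 : ℝ) ^ (s - 1) :=
            Real.rpow_le_rpow_of_nonpos (by norm_num) h1 h
        _ = 2 ^ (-(s - 1)) := by
            rw [one_div, Real.inv_rpow (by norm_num), Real.rpow_neg (by norm_num)]
  have hyx := abs_le.1 hxy
  have := Convex.norm_image_sub_le_of_norm_hasDerivWithin_le (f := fun t : ℝ => t ^ s)
    (f' := fun t => s * t ^ (s - 1)) (s := Set.Icc (x / 2) (2 * x)) (x := x) (y := y)
    (fun t ht => (Real.hasDerivAt_rpow_const (Or.inl (by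
      have := ht.1
      intro h0; rw [h0] at this; linarith))).hasDerivWithinAt) hb (convex_Icc _ _)
    ⟨by linarith, by linarith⟩ ⟨by linarith, by linarith⟩
  rw [Real.norm_eq_abs, Real.norm_eq_abs, abs_sub_comm y x] at this
  refine this.trans ?_
  exact mul_le_of_le_one_right (by positivity) hxy

lemma keyC_lt_top (hp : 0 < p) (hpq : p < q) : keyC p q < ⊤ := by
  have hq : 0 < q := hp.trans hpq
  unfold keyC
  set s := (p - 2) / q with hs
  rw [← lintegral_add_compl _ (Metric.isOpen_ball (x := (0 : ℂ)) (ε := 2)).measurableSet]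
  refine ENNReal.add_lt_top.2 ⟨?_, ?_⟩
  · have h1 : ∫⁻ z in Metric.ball (0 : ℂ) 2, ‖‖z - 1‖ ^ s‖ₑ ^ q < ⊤ := by
      refine lt_of_le_of_lt ?_ (ball_fin hp hq 3)
      rw [← lintegral_indicator Metric.isOpen_ball.measurableSet,
        ← lintegral_indicator Metric.isOpen_ball.measurableSet,
        ← lintegral_sub_right_eq_self
          ((Metric.ball (0 : ℂ) 3).indicator fun z => ‖‖z‖ ^ ((p - 2) / q)‖ₑ ^ q) (1 : ℂ)]
      refine lintegral_mono fun z => ?_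
      by_cases hz : z ∈ Metric.ball (0 : ℂ) 2
      · have hz' : z - 1 ∈ Metric.ball (0 : ℂ) 3 := by
          simp only [Metric.mem_ball, dist_zero_right] at hz ⊢
          calc ‖z - 1‖ ≤ ‖z‖ + ‖(1 : ℂ)‖ := norm_sub_le _ _
            _ < 3 := by rw [norm_one]; linarith
        rw [Set.indicator_of_mem hz, Set.indicator_of_mem hz']
      · rw [Set.indicator_of_notMem hz]
        exact zero_le
    have h2 := pInt_add_le (ν := volume.restrict (Metric.ball (0 : ℂ) 2)) hq
      (F := fun z : ℂ => ‖z - 1‖ ^ s) (H := fun z : ℂ => -‖z‖ ^ s) (by fun_prop)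
    unfold pInt at h2
    simp only [enorm_neg, ← sub_eq_add_neg] at h2
    refine h2.trans_lt ?_
    exact ENNReal.mul_lt_top (two_rpow_ne_top q).lt_top (ENNReal.add_lt_top.2 ⟨h1, ball_fin hp hq 2⟩)
  · have hr : (Module.finrank ℝ ℂ : ℝ) < 2 + q - p := by
      rw [Complex.finrank_real_complex]; push_cast; linarith
    have h1 := finite_integral_one_add_norm (μ := (volume : Measure ℂ)) hr
    set K : ℝ := (|s| * 2 ^ |s - 1|) ^ q * 2 ^ (2 + q - p) with hK
    have hK0 : 0 ≤ K := by positivity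
    have h3 : ∫⁻ z in (Metric.ball (0 : ℂ) 2)ᶜ, ‖‖z - 1‖ ^ s - ‖z‖ ^ s‖ₑ ^ q
        ≤ ∫⁻ z in (Metric.ball (0 : ℂ) 2)ᶜ,
          ENNReal.ofReal K * ENNReal.ofReal ((1 + ‖z‖) ^ (-(2 + q - p))) := by
      refine setLIntegral_mono (by fun_prop) fun z hz => ?_
      have hz2 : 2 ≤ ‖z‖ := by simpa using hz
      have hz0 : 0 < ‖z‖ := by linarith
      have hd : |‖z‖ - ‖z - 1‖| ≤ 1 := by
        have := abs_norm_sub_norm_le z (z - 1)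
        simpa using this
      have hd' := abs_le.1 hd
      have h4 := rpow_diff (s := s) hz2 (by linarith) hd
      rw [← ofReal_norm, Real.norm_eq_abs, ENNReal.ofReal_rpow_of_nonneg (abs_nonneg _) hq.le,
        ← ENNReal.ofReal_mul hK0]
      refine ENNReal.ofReal_le_ofReal ?_
      calc |‖z - 1‖ ^ s - ‖z‖ ^ s| ^ q ≤ (|s| * 2 ^ |s - 1| * ‖z‖ ^ (s - 1)) ^ q :=
            Real.rpow_le_rpow (abs_nonneg _) h4 hq.le
        _ = (|s| * 2 ^ |s - 1|) ^ q * ‖z‖ ^ (-(2 + q - p)) := by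
            rw [Real.mul_rpow (by positivity) (by positivity), ← Real.rpow_mul hz0.le]
            congr 2
            rw [hs]; field_simp; ring
        _ ≤ (|s| * 2 ^ |s - 1|) ^ q * ((1 + ‖z‖) / 2) ^ (-(2 + q - p)) := by
            refine mul_le_mul_of_nonneg_left ?_ (by positivity)
            exact Real.rpow_le_rpow_of_nonpos (by positivity) (by linarith) (by linarith)
        _ = K * (1 + ‖z‖) ^ (-(2 + q - p)) := by
            rw [Real.div_rpow (by positivity) (by norm_num), Real.rpow_neg (by norm_num : (0:ℝ) ≤ 2),
              hK]
            field_simp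
    refine h3.trans_lt ?_
    rw [lintegral_const_mul _ (by fun_prop)]
    exact ENNReal.mul_lt_top ofReal_lt_top ((setLIntegral_le_lintegral _ _).trans_lt h1)

lemma keyC_ne_zero (hp : 0 < p) (hp2 : p ≠ 2) (hpq : p < q) : keyC p q ≠ 0 := by
  have hq : 0 < q := hp.trans hpq
  unfold keyC
  have hs : (p - 2) / q ≠ 0 := div_ne_zero (sub_ne_zero.2 hp2) hq.ne'
  set s := (p - 2) / q
  intro h
  rw [lintegral_eq_zero_iff (by fun_prop)] at h
  have hU : IsOpen {z : ℂ | ‖z‖ < ‖z - 1‖} := isOpen_lt (by fun_prop) (by fun_prop)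
  have hpos := hU.measure_pos volume ⟨-1, by norm_num⟩
  refine hpos.ne' (measure_mono_null ?_ h)
  intro z hz
  simp only [Set.mem_setOf_eq] at hz
  simp only [Set.mem_compl_iff, Set.mem_setOf_eq, Pi.zero_apply]
  intro h0
  rw [ENNReal.rpow_eq_zero_iff_of_pos hq, enorm_eq_zero, sub_eq_zero] at h0
  have := (Real.rpow_left_inj (norm_nonneg _) (norm_nonneg _) hs).1 h0
  linarith

end keyint


section proddata
open Filter Topology

variable {X : Type*} [MeasurableSpace X] {μ : Measure X} {p q : ℝ}

/-- The linear part of Lamperti data as a linear map. -/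
noncomputable def LampData.lin {T : (X → ℂ) → (X → ℂ)} (D : LampData μ p T) (x : X) : ℂ →ₗ[ℝ] ℂ where
  toFun u := D.lam x • Rab (D.a x) (D.b x) u
  map_add' u v := by simp only [Rab, Complex.add_re, Complex.add_im]; module
  map_smul' t u := by
    simp only [Rab, Complex.real_smul, Complex.re_ofReal_mul, Complex.im_ofReal_mul, RingHom.id_apply]
    push_cast
    ring

lemma LampData.norm_lin {T : (X → ℂ) → (X → ℂ)} (D : LampData μ p T) (x : X) (u : ℂ) :
    ‖D.lin x u‖ = D.lam x * ‖u‖ := by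
  show ‖D.lam x • Rab (D.a x) (D.b x) u‖ = _
  rw [norm_smul, norm_Rab (D.na x) (D.nb x) (D.orth x), Real.norm_of_nonneg (D.lam_pos x).le]

lemma LampData.lin_inj {T : (X → ℂ) → (X → ℂ)} (D : LampData μ p T) (x : X) {u : ℂ}
    (h : D.lin x u = 0) : u = 0 := by
  have := D.norm_lin x u
  rw [h, norm_zero] at this
  exact norm_eq_zero.1 ((mul_eq_zero.1 this.symm).resolve_left (D.lam_pos x).ne')

lemma LampData.qmp {T : (X → ℂ) → (X → ℂ)} (D : LampData μ p T) (hp : 0 < p) :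
    Measure.QuasiMeasurePreserving D.τ μ μ := by
  refine ⟨D.hτ, ?_⟩
  refine Measure.AbsolutelyContinuous.mk fun s hs h0 => ?_
  rw [Measure.map_apply D.hτ hs]
  have h := D.hmap (s.indicator 1) (measurable_one.indicator hs)
  rw [lintegral_indicator_one hs, h0] at h
  have hm : Measurable fun y => ENNReal.ofReal (D.lam y) ^ p * s.indicator 1 (D.τ y) := by
    have := D.hlam
    have h2 : Measurable fun y => s.indicator (1 : X → ℝ≥0∞) (D.τ y) :=
      (measurable_one.indicator hs).comp D.hτ
    fun_prop
  rw [lintegral_eq_zero_iff hm] at h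
  refine measure_mono_null ?_ h
  intro y hy
  have hy' : D.τ y ∈ s := hy
  have hw := D.lam_pos y
  simp [hy', ENNReal.rpow_eq_zero_iff, hp.le, hw]

lemma affine_uniq [SigmaFinite μ] [StandardBorelSpace X] (hp : 0 < p) {τ τ' : X → X} {c c' : X → ℂ}
    {l l' : X → ℂ →ₗ[ℝ] ℂ} (hl : ∀ x u, l x u = 0 → u = 0) (hl' : ∀ x u, l' x u = 0 → u = 0)
    (h : ∀ F, InL μ p F → ∀ᵐ x ∂μ, c x + l x (F (τ x)) = c' x + l' x (F (τ' x))) :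
    ∀ᵐ x ∂μ, τ x = τ' x ∧ c x = c' x ∧ l x = l' x := by
  obtain ⟨h0, h0m, h0p, hh⟩ := exists_posL μ hp
  have hih : InL μ p (fun x => Complex.I * h0 x) :=
    hh.mono hp (by fun_prop) fun x => by simp
  have h1 := h _ (InL.zero hp)
  simp only [map_zero, add_zero] at h1
  set ι := MeasurableSpace.mapNatBool X with hι
  have hιm : Measurable ι := MeasurableSpace.measurable_mapNatBool X
  let A : ℕ → Set X := fun n => ι ⁻¹' {y | y n = true}
  have hC0 : ∀ n, MeasurableSet {y : ℕ → Bool | y n = true} := fun n =>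
    measurableSet_eq_fun (measurable_pi_apply n) measurable_const
  have hA : ∀ n, MeasurableSet (A n) := fun n => hιm (hC0 n)
  have h2 := ae_all_iff.2 fun n => h _ (hh.indicator hp (hA n))
  filter_upwards [h1, h2, h _ hh, h _ hih] with x h1 h2 h3 h4
  have hτ : τ x = τ' x := by
    apply MeasurableSpace.injective_mapNatBool X
    ext n
    have h5 := h2 n
    rw [h1] at h5
    replace h5 := add_left_cancel h5
    have hne : ∀ y, (h0 y : ℂ) ≠ 0 := fun y => by exact_mod_cast (h0p y).ne'
    have : τ x ∈ A n ↔ τ' x ∈ A n := by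
      by_cases ha : τ x ∈ A n <;> by_cases hb : τ' x ∈ A n
      · simp [ha, hb]
      · rw [Set.indicator_of_mem ha, Set.indicator_of_notMem hb, map_zero] at h5
        exact absurd (hl _ _ h5) (hne _)
      · rw [Set.indicator_of_notMem ha, Set.indicator_of_mem hb, map_zero] at h5
        exact absurd (hl' _ _ h5.symm) (hne _)
      · simp [ha, hb]
    have e : ι (τ x) n = true ↔ ι (τ' x) n = true := this
    exact Bool.eq_iff_iff.2 e
  refine ⟨hτ, h1, ?_⟩
  rw [h1] at h3 h4
  replace h3 := add_left_cancel h3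
  replace h4 := add_left_cancel h4
  rw [← hτ] at h3 h4
  have hpos := h0p (τ x)
  ext u
  have hu : u = (u.re / h0 (τ x)) • (h0 (τ x) : ℂ) + (u.im / h0 (τ x)) • (Complex.I * h0 (τ x)) := by
    have hc : (h0 (τ x) : ℂ) ≠ 0 := by exact_mod_cast hpos.ne'
    simp only [Complex.real_smul]
    conv_lhs => rw [← Complex.re_add_im u]
    push_cast
    field_simp
  rw [hu, map_add, map_add, map_smul, map_smul, map_smul, map_smul, h3, h4]

variable {G : Type*} [Group G] [TopologicalSpace G]

section cocycle
variable [SigmaFinite μ] [StandardBorelSpace X] (A : FnAct G μ p) (D : ∀ g, LampData μ p (A.U g))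

lemma fn_repr (g : G) {F : X → ℂ} (hF : InL μ p F) :
    ∀ᵐ x ∂μ, A.fn g F x = A.c g x + (D g).lin x (F ((D g).τ x)) := by
  filter_upwards [(D g).repr F hF] with x hx
  have : A.U g F x = (D g).lin x (F ((D g).τ x)) := hx
  rw [← this]
  simp [FnAct.U]

lemma coc_one (hp : 0 < p) : ∀ᵐ x ∂μ, (D 1).τ x = x ∧ A.c 1 x = 0 ∧ (D 1).lin x = LinearMap.id := by
  refine affine_uniq (μ := μ) (p := p) (τ' := fun x => x) (c' := fun _ => 0)
    (l' := fun _ => LinearMap.id) hp (fun x u h => (D 1).lin_inj x h) (fun x u h => h) ?_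
  intro F hF
  filter_upwards [fn_repr A D 1 hF, A.one F hF] with x h1 h2
  rw [← h1, h2]
  simp

lemma coc_mul (hp : 0 < p) (g h : G) : ∀ᵐ x ∂μ, (D (g * h)).τ x = (D h).τ ((D g).τ x) ∧
    A.c (g * h) x = A.c g x + (D g).lin x (A.c h ((D g).τ x)) ∧
    (D (g * h)).lin x = ((D g).lin x).comp ((D h).lin ((D g).τ x)) := by
  refine affine_uniq (μ := μ) (p := p) (τ' := fun x => (D h).τ ((D g).τ x))
    (c' := fun x => A.c g x + (D g).lin x (A.c h ((D g).τ x)))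
    (l' := fun x => ((D g).lin x).comp ((D h).lin ((D g).τ x)))
    hp (fun x u h => (D _).lin_inj x h)
    (fun x u hu => (D h).lin_inj _ ((D g).lin_inj x hu)) ?_
  intro F hF
  filter_upwards [fn_repr A D (g * h) hF, A.mul g h F hF, fn_repr A D g (A.mem h F hF),
    ((D g).qmp hp).ae (fn_repr A D h hF)] with x h1 h2 h3 h4
  rw [← h1, h2, h3, h4]
  simp only [map_add, LinearMap.comp_apply]
  ring

/-- The skew transformation. -/
noncomputable def skS (g : G) (y : X × ℂ) : X × ℂ :=
  ((D g).τ y.1, Rinv ((D g).a y.1) ((D g).b y.1) (((D g).lam y.1)⁻¹ • (y.2 - A.c g y.1)))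

lemma lin_skS (g : G) (y : X × ℂ) : A.c g y.1 + (D g).lin y.1 (skS A D g y).2 = y.2 := by
  show A.c g y.1 + (D g).lam y.1 • Rab ((D g).a y.1) ((D g).b y.1) (Rinv _ _ _) = _
  rw [Rab_Rinv ((D g).na _) ((D g).nb _) ((D g).orth _), smul_inv_smul₀ ((D g).lam_pos _).ne']
  ring

lemma meas_Rinv {Y : Type*} [MeasurableSpace Y] {a b z : Y → ℂ} (ha : Measurable a)
    (hb : Measurable b) (hz : Measurable z) : Measurable fun y => Rinv (a y) (b y) (z y) := by
  have : (fun y => Rinv (a y) (b y) (z y)) = fun y => 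
    (((a y).re * (z y).re + (a y).im * (z y).im : ℝ) : ℂ) +
    (((b y).re * (z y).re + (b y).im * (z y).im : ℝ) : ℂ) * Complex.I := by
    ext y
    apply Complex.ext <;> simp [Rinv]
  rw [this]
  fun_prop

lemma meas_skS (hp : 0 < p) (g : G) : Measurable (skS A D g) := by
  have h1 := (D g).ha
  have h2 := (D g).hb
  have h3 := (D g).hlam
  have h4 := (A.c_mem hp g).1
  have h5 := (D g).hτ
  unfold skS
  refine Measurable.prodMk (by fun_prop) (meas_Rinv (by fun_prop) (by fun_prop) (by fun_prop))

/-- The radial functions. -/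
noncomputable def Psi (p q : ℝ) (f : X → ℂ) (y : X × ℂ) : ℝ := ‖y.2 - f y.1‖ ^ ((p - 2) / q)

lemma meas_Psi {f : X → ℂ} (hf : Measurable f) : Measurable (Psi p q f) := by
  unfold Psi; fun_prop

lemma pInt_Psi (hp : 0 < p) (hpq : p < q) {f f' : X → ℂ} (hf : Measurable f) (hf' : Measurable f') :
    pInt (μ.prod (volume : Measure ℂ)) q (fun y => Psi p q f y - Psi p q f' y)
      = keyC p q * pInt μ p (fun x => f x - f' x) := by
  unfold pInt
  have hm := (meas_Psi (p := p) (q := q) hf).sub (meas_Psi (p := p) (q := q) hf')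
  rw [lintegral_prod _ (by
    have := hm.enorm.pow_const q
    exact this.aemeasurable), ← lintegral_const_mul _ (by fun_prop)]
  refine lintegral_congr fun x => ?_
  exact keyint hp hpq (f x) (f' x)

lemma Psi_S (hp : 0 < p) (g : G) {f : X → ℂ} (hf : InL μ p f) :
    ∀ᵐ y ∂(μ.prod (volume : Measure ℂ)),
      ((D g).lam y.1) ^ ((p - 2) / q) * Psi p q f (skS A D g y) = Psi p q (A.fn g f) y := by
  filter_upwards [Measure.quasiMeasurePreserving_fst.ae (fn_repr A D g hf)] with y hy
  have h1 := lin_skS A D g y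
  unfold Psi
  rw [← Real.mul_rpow ((D g).lam_pos _).le (norm_nonneg _), ← (D g).norm_lin, map_sub, hy]
  congr 2
  conv_rhs => rw [← h1]
  simp only [skS]
  ring

/-- The Psi_sub form. -/
lemma Psi_sub_S (hp : 0 < p) (g : G) {f f' : X → ℂ} (hf : InL μ p f) (hf' : InL μ p f') :
    ∀ᵐ y ∂(μ.prod (volume : Measure ℂ)),
      ((D g).lam y.1) ^ ((p - 2) / q) * (Psi p q f (skS A D g y) - Psi p q f' (skS A D g y))
        = Psi p q (A.fn g f) y - Psi p q (A.fn g f') y := by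
  filter_upwards [Psi_S (q := q) A D hp g hf, Psi_S (q := q) A D hp g hf'] with y h1 h2
  rw [mul_sub, h1, h2]

/-- The nonsingular data on `X × ℂ`. -/
noncomputable def skData (hp : 0 < p) (hpq : p < q) : NSData G (μ.prod (volume : Measure ℂ)) q where
  S := skS A D
  w g y := ((D g).lam y.1) ^ ((p - 2) / q)
  b g y := Psi p q (A.c g) y - Psi p q (fun _ => 0) y
  hS := meas_skS A D hp
  hw g := by have := (D g).hlam; fun_prop
  hb g := (meas_Psi (A.c_mem hp g).1).sub (meas_Psi measurable_const)
  hw0 g y := Real.rpow_pos_of_pos ((D g).lam_pos _) _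
  hmap g F hF := by
    have hq : 0 < q := hp.trans hpq
    have hl := (D g).hlam
    have hS := meas_skS A D hp g
    rw [lintegral_prod _ (by
      refine Measurable.aemeasurable ?_
      refine Measurable.mul (by fun_prop) (hF.comp hS)), lintegral_prod _ hF.aemeasurable,
      ← (D g).hmap (fun x => ∫⁻ z, F (x, z)) hF.lintegral_prod_right']
    refine lintegral_congr fun x => ?_
    simp only
    have hx := (D g).lam_pos x
    have hFx : Measurable fun z => F ((D g).τ x, z) := by fun_prop
    rw [lintegral_const_mul _ (by
      have : Measurable fun z : ℂ => skS A D g (x, z) := hS.comp (by fun_prop)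
      exact hF.comp this)]
    have := lint_aff ((D g).na x) ((D g).nb x) ((D g).orth x) _ hx (A.c g x) hFx
    simp only [skS]
    rw [this, ← mul_assoc]
    congr 1
    rw [← ofReal_norm, Real.norm_of_nonneg (by positivity), ENNReal.ofReal_rpow_of_pos (by positivity),
      ENNReal.ofReal_rpow_of_pos hx, ← ENNReal.ofReal_mul (by positivity)]
    congr 1
    rw [← Real.rpow_mul hx.le, ← Real.rpow_natCast, ← Real.rpow_add hx]
    congr 1
    field_simp
    push_cast
    ring
  hone := by
    filter_upwards [Measure.quasiMeasurePreserving_fst.ae (coc_one A D hp)] with y hy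
    have h1 := lin_skS A D 1 y
    rw [hy.2.1, hy.2.2, zero_add] at h1
    refine ⟨Prod.ext hy.1 h1, ?_⟩
    have := (D 1).norm_lin y.1 1
    rw [hy.2.2] at this
    simp at this
    rw [← this, Real.one_rpow]
  hmul g h := by
    filter_upwards [Measure.quasiMeasurePreserving_fst.ae (coc_mul A D hp g h)] with y hy
    have h1 := lin_skS A D (g * h) y
    have h2 := lin_skS A D g y
    have h3 := lin_skS A D h (skS A D g y)
    have e : (skS A D g y).1 = (D g).τ y.1 := rfl
    rw [e] at h3
    refine ⟨Prod.ext hy.1 ?_, ?_⟩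
    · rw [hy.2.1, hy.2.2, ← h2, ← h3, map_add, LinearMap.comp_apply] at h1
      have h4 : (D g).lin y.1 ((D h).lin ((D g).τ y.1) ((skS A D (g * h) y).2
          - (skS A D h (skS A D g y)).2)) = 0 := by
        rw [map_sub, map_sub, sub_eq_zero]
        linear_combination h1
      exact sub_eq_zero.1 ((D h).lin_inj _ ((D g).lin_inj _ h4))
    · rw [e, ← Real.mul_rpow ((D g).lam_pos _).le ((D h).lam_pos _).le]
      congr 1
      have h5 := (D (g * h)).norm_lin y.1 1
      rw [hy.2.2, LinearMap.comp_apply, (D g).norm_lin, (D h).norm_lin] at h5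
      simpa using h5.symm
  hbfin g := by
    rw [pInt_Psi hp hpq (A.c_mem hp g).1 measurable_const]
    simp only [sub_zero]
    exact ENNReal.mul_lt_top (keyC_lt_top hp hpq) (A.c_mem hp g).2
  hbmul g h := by
    have h0 := A.mul g h _ (InL.zero hp)
    filter_upwards [Psi_sub_S (q := q) A D hp g (A.c_mem hp h) (InL.zero hp),
      Measure.quasiMeasurePreserving_fst.ae h0] with y h1 h2
    rw [h1]
    have e : Psi p q (A.fn g (A.c h)) y = Psi p q (A.c (g * h)) y := by
      unfold Psi
      rw [FnAct.c, FnAct.c, h2]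
    rw [e]
    show _ = Psi p q (A.c g) y - _ + (_ - Psi p q (A.c g) y)
    ring
  hbc := by
    have := A.cont _ (InL.zero hp)
    refine NSData.tendsto_zero_of_le (keyC p q) (keyC_lt_top hp hpq).ne this fun g => ?_
    rw [pInt_Psi hp hpq (A.c_mem hp g).1 measurable_const]
    rfl

lemma cont_Psi (hp : 0 < p) (hpq : p < q) {f f' : X → ℂ} (hf : InL μ p f) (hf' : InL μ p f') :
    (skData A D hp hpq).Cont (fun y => Psi p q f y - Psi p q f' y) := by
  have hq : 0 < q := hp.trans hpq
  have hK := keyC_lt_top hp hpq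
  refine ⟨((meas_Psi hf.1).sub (meas_Psi hf'.1)).aemeasurable, ?_, ?_⟩
  · rw [pInt_Psi hp hpq hf.1 hf'.1]
    exact ENNReal.mul_lt_top hK (hf.sub hp hf').2
  · have := (A.cont f hf).add (A.cont f' hf')
    rw [add_zero] at this
    refine NSData.tendsto_zero_of_le (2 ^ q * keyC p q)
      (ENNReal.mul_ne_top (two_rpow_ne_top q) hK.ne) this fun g => ?_
    have hg := (A.mem g f hf).1
    have hg' := (A.mem g f' hf').1
    have e : pInt (μ.prod (volume : Measure ℂ)) q (fun y => (skData A D hp hpq).w g y •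
          (Psi p q f ((skData A D hp hpq).S g y) - Psi p q f' ((skData A D hp hpq).S g y))
          - (Psi p q f y - Psi p q f' y))
        = pInt (μ.prod (volume : Measure ℂ)) q (fun y => (Psi p q (A.fn g f) y - Psi p q f y)
          + (Psi p q f' y - Psi p q (A.fn g f') y)) := by
      refine pInt_congr ?_
      filter_upwards [Psi_sub_S (q := q) A D hp g hf hf'] with y hy
      have hy' : (skData A D hp hpq).w g y •
          (Psi p q f ((skData A D hp hpq).S g y) - Psi p q f' ((skData A D hp hpq).S g y)) =
          Psi p q (A.fn g f) y - Psi p q (A.fn g f') y := hy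
      rw [hy']
      congr 1
      ring
    rw [e]
    refine (pInt_add_le (F := fun y => Psi p q (A.fn g f) y - Psi p q f y)
      (H := fun y => Psi p q f' y - Psi p q (A.fn g f') y) hq ((meas_Psi hg).sub (meas_Psi hf.1)).aemeasurable).trans ?_
    rw [pInt_Psi hp hpq hg hf.1, pInt_Psi hp hpq hf'.1 hg', mul_assoc, mul_add]
    have e2 : pInt μ p (fun x => f' x - A.fn g f' x) = pInt μ p (fun x => A.fn g f' x - f' x) :=
      pInt_congr (ae_of_all _ fun x => enorm_sub_rev _ _)
    rw [e2, mul_add, mul_add]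

end cocycle
end proddata


section density
open Filter Topology

variable {X : Type*} [MeasurableSpace X] {μ : Measure X} {p q : ℝ}

lemma re_null (c : ℝ) : (volume : Measure ℂ) {z : ℂ | z.re = c} = 0 := by
  have h := Complex.volume_preserving_equiv_real_prod.measure_preimage_equiv ({c} ×ˢ Set.univ)
  have e : (Complex.measurableEquivRealProd ⁻¹' ({c} ×ˢ Set.univ) : Set ℂ) = {z : ℂ | z.re = c} := by
    ext z; simp [Complex.measurableEquivRealProd]
  rw [e] at h
  rw [h, Measure.volume_eq_prod, Measure.prod_prod]
  simp

lemma re_ae [SigmaFinite μ] {c : X → ℝ} (hc : Measurable c) :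
    ∀ᵐ y ∂(μ.prod (volume : Measure ℂ)), y.2.re ≠ c y.1 := by
  have hm : MeasurableSet {y : X × ℂ | y.2.re = c y.1} :=
    measurableSet_eq_fun (Complex.measurable_re.comp measurable_snd) (hc.comp measurable_fst)
  rw [ae_iff]
  simp only [ne_eq, not_not]
  rw [Measure.measure_prod_null hm]
  exact ae_of_all _ fun x => re_null (c x)

lemma sign_iff {s a b : ℝ} (hs : s ≠ 0) (ha : 0 < a) (hb : 0 < b) :
    0 < SignType.sign s * (b ^ s - a ^ s) ↔ a < b := by
  rcases lt_or_gt_of_ne hs with h | h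
  · rw [sign_neg h]
    have := Real.rpow_lt_rpow_iff_of_neg hb ha h
    rw [← this]
    simp
  · rw [sign_pos h]
    have := Real.rpow_lt_rpow_iff ha.le hb.le h
    rw [← this]
    simp

lemma closer_re (t h : ℝ) (hh : 0 < h) (z : ℂ) :
    ‖z - (h : ℂ) * ((t + 1 : ℝ) : ℂ)‖ < ‖z - (h : ℂ) * ((t - 1 : ℝ) : ℂ)‖ ↔ t < z.re / h := by
  rw [lt_div_iff₀ hh, ← sq_lt_sq₀ (norm_nonneg _) (norm_nonneg _), ← Complex.normSq_eq_norm_sq,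
    ← Complex.normSq_eq_norm_sq, Complex.normSq_apply, Complex.normSq_apply]
  simp only [Complex.sub_re, Complex.sub_im, Complex.re_ofReal_mul, Complex.im_ofReal_mul,
    Complex.ofReal_re, Complex.ofReal_im]
  constructor
  · intro H
    by_contra! H2
    nlinarith
  · intro H
    nlinarith

lemma closer_im (t h : ℝ) (hh : 0 < h) (z : ℂ) :
    ‖z - (h : ℂ) * (((t + 1 : ℝ) : ℂ) * Complex.I)‖ < ‖z - (h : ℂ) * (((t - 1 : ℝ) : ℂ) * Complex.I)‖
      ↔ t < z.im / h := by
  rw [lt_div_iff₀ hh, ← sq_lt_sq₀ (norm_nonneg _) (norm_nonneg _), ← Complex.normSq_eq_norm_sq,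
    ← Complex.normSq_eq_norm_sq, Complex.normSq_apply, Complex.normSq_apply]
  simp only [Complex.sub_re, Complex.sub_im, Complex.re_ofReal_mul, Complex.im_ofReal_mul,
    Complex.ofReal_re, Complex.ofReal_im, Complex.I_re, Complex.I_im]
  constructor
  · intro H
    by_contra! H2
    nlinarith
  · intro H
    nlinarith

lemma prod_le_of {m : MeasurableSpace (X × ℂ)} {h : X → ℝ} (hh : Measurable h) (h0 : ∀ x, 0 < h x)
    (h1 : ∀ A : Set X, MeasurableSet A → MeasurableSet[m] (Prod.fst ⁻¹' A : Set (X × ℂ)))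
    (h2 : ∀ t : ℝ, MeasurableSet[m] {y : X × ℂ | t < y.2.re / h y.1})
    (h3 : ∀ t : ℝ, MeasurableSet[m] {y : X × ℂ | t < y.2.im / h y.1}) :
    (Prod.instMeasurableSpace : MeasurableSpace (X × ℂ)) ≤ m := by
  have f1 : Measurable[m] (Prod.fst : X × ℂ → X) := fun A hA => h1 A hA
  have f2 : Measurable[m] (fun y : X × ℂ => y.2.re / h y.1) := measurable_of_Ioi h2
  have f3 : Measurable[m] (fun y : X × ℂ => y.2.im / h y.1) := measurable_of_Ioi h3
  have fh : Measurable[m] (fun y : X × ℂ => h y.1) := hh.comp f1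
  have f4 : Measurable[m] (fun y : X × ℂ => y.2) := by
    have e : (fun y : X × ℂ => y.2) = fun y : X × ℂ =>
        (((y.2.re / h y.1 * h y.1 : ℝ) : ℂ) + ((y.2.im / h y.1 * h y.1 : ℝ) : ℂ) * Complex.I) := by
      funext y
      rw [div_mul_cancel₀ _ (h0 _).ne', div_mul_cancel₀ _ (h0 _).ne', Complex.re_add_im]
    rw [e]
    exact (Complex.measurable_ofReal.comp (f2.mul fh)).add
      ((Complex.measurable_ofReal.comp (f3.mul fh)).mul measurable_const)
  exact sup_le f1.comap_le f4.comap_le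

variable {G : Type*} [Group G] [TopologicalSpace G]
variable [SigmaFinite μ] [StandardBorelSpace X] (A : FnAct G μ p) (D : ∀ g, LampData μ p (A.U g))

lemma cont_all (hp : 0 < p) (hp2 : p ≠ 2) (hpq : p < q) (F : X × ℂ → ℝ)
    (hF : AEMeasurable F (μ.prod (volume : Measure ℂ)))
    (hFfin : pInt (μ.prod (volume : Measure ℂ)) q F < ⊤) : (skData A D hp hpq).Cont F := by
  have hq : 0 < q := hp.trans hpq
  have hs : (p - 2) / q ≠ 0 := div_ne_zero (sub_ne_zero.2 hp2) hq.ne'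
  obtain ⟨h, hm, h0, hL⟩ := exists_posL μ hp
  have hLu : ∀ u : ℂ, InL μ p (fun x => (h x : ℂ) * u) := fun u => by
    have h1 := hL.smul hp ‖u‖
    refine h1.mono hp (by fun_prop) fun x => ?_
    simp [mul_comm]
  set F' : X × ℂ → ℝ := fun y => |Psi p q (fun x => (h x : ℂ)) y - Psi p q (fun _ => 0) y| with hF'
  have cF' : (skData A D hp hpq).Cont F' := (cont_Psi A D hp hpq hL (InL.zero hp)).abs hq
  have hF00 : ∀ᵐ y ∂(μ.prod (volume : Measure ℂ)), 0 ≤ F' y := ae_of_all _ fun y => abs_nonneg _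
  have hF0 : ∀ᵐ y ∂(μ.prod (volume : Measure ℂ)), 0 < F' y := by
    filter_upwards [re_ae (μ := μ) (c := fun x => h x / 2) (by fun_prop)] with y hy
    rw [hF', abs_pos, sub_ne_zero]
    intro he
    have := (Real.rpow_left_inj (norm_nonneg _) (norm_nonneg _) hs).1 he
    have h2 : ‖y.2 - (h y.1 : ℂ)‖ ^ 2 = ‖y.2 - 0‖ ^ 2 := by rw [this]
    rw [← Complex.normSq_eq_norm_sq, ← Complex.normSq_eq_norm_sq, Complex.normSq_apply,
      Complex.normSq_apply] at h2
    simp only [Complex.sub_re, Complex.sub_im, Complex.ofReal_re, Complex.ofReal_im,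
      Complex.zero_re, Complex.zero_im, sub_zero] at h2
    apply hy
    have h3 : h y.1 * (h y.1 - 2 * y.2.re) = 0 := by nlinarith
    rcases mul_eq_zero.1 h3 with h4 | h4
    · exact absurd h4 (h0 _).ne'
    · linarith
  have key : ∀ u v : ℂ, (skData A D hp hpq).Cont
      ({y : X × ℂ | ‖y.2 - (h y.1 : ℂ) * u‖ < ‖y.2 - (h y.1 : ℂ) * v‖}.indicator F') := by
    intro u v
    have cH := (cont_Psi A D hp hpq (hLu v) (hLu u)).smul hq
      ((SignType.sign ((p - 2) / q) : SignType) : ℝ)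
    refine (cF'.indicator_pos hq hF00 cH).congr hq ?_
    filter_upwards [re_ae (μ := μ) (c := fun x => h x * u.re) (by fun_prop),
      re_ae (μ := μ) (c := fun x => h x * v.re) (by fun_prop)] with y h1 h2
    have hu : 0 < ‖y.2 - (h y.1 : ℂ) * u‖ := by
      rw [norm_pos_iff, sub_ne_zero]
      intro e; exact h1 (by rw [e]; simp)
    have hv : 0 < ‖y.2 - (h y.1 : ℂ) * v‖ := by
      rw [norm_pos_iff, sub_ne_zero]
      intro e; exact h2 (by rw [e]; simp)
    have hi := sign_iff hs hu hv
    by_cases hc : ‖y.2 - (h y.1 : ℂ) * u‖ < ‖y.2 - (h y.1 : ℂ) * v‖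
    · rw [Set.indicator_of_mem (by exact hi.2 hc), Set.indicator_of_mem (by exact hc)]
    · rw [Set.indicator_of_notMem (by exact fun H => hc (hi.1 H)),
        Set.indicator_of_notMem (by exact hc)]
  refine NSData.cont_of_sigE hq cF' hF0 hF00 ?_ hF hFfin
  refine prod_le_of hm h0 (fun B hB => ?_) (fun t => ?_) (fun t => ?_)
  · change (skData A D hp hpq).Cont ((Prod.fst ⁻¹' B).indicator F')
    refine ((cont_Psi A D hp hpq (hL.indicator hp hB) (InL.zero hp)).abs hq).congr hq
      (ae_of_all _ fun y => ?_)
    by_cases hy : y.1 ∈ B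
    · rw [Set.indicator_of_mem (by exact hy)]
      simp [hF', Psi, hy]
    · rw [Set.indicator_of_notMem (by exact hy)]
      simp [Psi, hy]
  · have := key ((t + 1 : ℝ) : ℂ) ((t - 1 : ℝ) : ℂ)
    have e : {y : X × ℂ | t < y.2.re / h y.1} = {y : X × ℂ |
      ‖y.2 - (h y.1 : ℂ) * ((t + 1 : ℝ) : ℂ)‖ < ‖y.2 - (h y.1 : ℂ) * ((t - 1 : ℝ) : ℂ)‖} := by
      ext y; exact (closer_re t _ (h0 _) _).symm
    rw [e]; exact this
  · have := key (((t + 1 : ℝ) : ℂ) * Complex.I) (((t - 1 : ℝ) : ℂ) * Complex.I)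
    have e : {y : X × ℂ | t < y.2.im / h y.1} = {y : X × ℂ |
      ‖y.2 - (h y.1 : ℂ) * (((t + 1 : ℝ) : ℂ) * Complex.I)‖ <
        ‖y.2 - (h y.1 : ℂ) * (((t - 1 : ℝ) : ℂ) * Complex.I)‖} := by
      ext y; exact (closer_im t _ (h0 _) _).symm
    rw [e]; exact this

theorem lamperti_case [IsTopologicalGroup G] (hp : 0 < p) (hp2 : p ≠ 2) (hpq : p < q)
    (A : FnAct G μ p) : ∃ β : AffineIsometricAction G (μ.prod (volume : Measure ℂ)) q,
      β.MetricallyProper := by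
  have hq : 0 < q := hp.trans hpq
  have D : ∀ g, LampData μ p (A.U g) := fun g =>
    (IsoOp.exists_lamp (A.U_isoOp hp g) hp hp2).some
  refine NSData.exists_action (skData A D hp hpq) hq (cont_all A D hp hp2 hpq) fun R hR => ?_
  have hk := keyC_ne_zero hp hp2 hpq
  have := A.proper (R / keyC p q) (ENNReal.div_ne_top hR hk)
  convert this using 3
  ext g
  have e : pInt (μ.prod (volume : Measure ℂ)) q ((skData A D hp hpq).b g)
      = keyC p q * pInt μ p (A.fn g (fun _ => 0)) := by
    have := pInt_Psi (μ := μ) hp hpq (A.c_mem hp g).1 (measurable_const (a := (0:ℂ)))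
    simp only [sub_zero] at this
    exact this
  rw [e, mul_comm,
    ENNReal.le_div_iff_mul_le (Or.inl hk) (Or.inl (keyC_lt_top hp hpq).ne)]

end density


section gauss
open Filter Topology ProbabilityTheory

lemma Lp_coeFn_sum {Ω κ : Type*} [MeasurableSpace Ω] {P : Measure Ω} (s : Finset κ)
    (f : κ → Lp ℝ 2 P) : ∀ᵐ ω ∂P, (∑ i ∈ s, f i : Lp ℝ 2 P) ω = ∑ i ∈ s, f i ω := by
  classical
  induction s using Finset.induction_on with
  | empty =>
    simp only [Finset.sum_empty]
    filter_upwards [Lp.coeFn_zero ℝ 2 P] with ω h using h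
  | insert a s ha ih =>
    rw [Finset.sum_insert ha]
    filter_upwards [ih, Lp.coeFn_add (f a) (∑ i ∈ s, f i)] with ω h1 h2
    rw [h2, Finset.sum_insert ha, Pi.add_apply, h1]

lemma cexp_lip (a b : ℝ) : ‖Complex.exp (a * Complex.I) - Complex.exp (b * Complex.I)‖ ≤ |a - b| := by
  have e : Complex.exp (a * Complex.I) - Complex.exp (b * Complex.I)
      = Complex.exp (b * Complex.I) * (Complex.exp (Complex.I * ((a - b : ℝ) : ℂ)) - 1) := by
    rw [mul_sub, ← Complex.exp_add, mul_one]
    congr 2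
    push_cast
    ring
  rw [e, norm_mul, Complex.norm_exp_ofReal_mul_I, one_mul]
  exact Real.norm_exp_I_mul_ofReal_sub_one_le

/-- The expectation of `exp (i F)`. -/
noncomputable def chE {Ω : Type*} [MeasurableSpace Ω] (P : Measure Ω) (F : Ω → ℝ) : ℂ :=
  ∫ ω, Complex.exp (F ω * Complex.I) ∂P

lemma chE_congr {Ω : Type*} [MeasurableSpace Ω] {P : Measure Ω} {F F' : Ω → ℝ} (h : F =ᵐ[P] F') :
    chE P F = chE P F' := integral_congr_ae (h.mono fun ω hω => by simp only [hω])

lemma chE_continuous {Ω : Type*} [MeasurableSpace Ω] {P : Measure Ω} [IsProbabilityMeasure P] :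
    Continuous (fun F : Lp ℝ 2 P => chE P F) := by
  have h_integr : ∀ F : Lp ℝ 2 P, Integrable (fun ω => Complex.exp (F ω * Complex.I)) P := fun F => by
    refine Integrable.of_bound (C := 1) ?_ (ae_of_all _ fun ω => ?_)
    · have := (Lp.stronglyMeasurable F).measurable
      exact Measurable.aestronglyMeasurable (by fun_prop)
    · rw [Complex.norm_exp_ofReal_mul_I]
  refine (LipschitzWith.of_dist_le_mul (K := 1) fun F F' => ?_).continuous
  rw [dist_eq_norm, dist_eq_norm, NNReal.coe_one, one_mul]
  unfold chE
  rw [← integral_sub (h_integr F) (h_integr F')]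
  have h1 : Integrable (fun ω => (F - F' : Lp ℝ 2 P) ω) P :=
    (Lp.memLp (F - F')).integrable (by norm_num)
  calc ‖∫ ω, (Complex.exp (F ω * Complex.I) - Complex.exp (F' ω * Complex.I)) ∂P‖
      ≤ ∫ ω, ‖(F - F' : Lp ℝ 2 P) ω‖ ∂P := by
        refine norm_integral_le_of_norm_le h1.norm ?_
        filter_upwards [Lp.coeFn_sub F F'] with ω hω
        rw [hω]
        exact cexp_lip _ _
    _ = (eLpNorm (F - F' : Lp ℝ 2 P) 1 P).toReal := by
        rw [integral_norm_eq_lintegral_enorm h1.1, eLpNorm_one_eq_lintegral_enorm]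
    _ ≤ (eLpNorm (F - F' : Lp ℝ 2 P) 2 P).toReal :=
        ENNReal.toReal_mono (Lp.memLp _).2.ne
          (eLpNorm_le_eLpNorm_of_exponent_le (by norm_num) (Lp.memLp _).1)
    _ = ‖F - F'‖ := rfl

variable {ι : Type*} 

/-- The standard Gaussian product measure. -/
noncomputable def gP (ι : Type*) : Measure (ι → ℝ) := Measure.infinitePi (fun _ : ι => gaussianReal 0 1)

instance : IsProbabilityMeasure (gP ι) := by unfold gP; infer_instance

lemma gP_eval (i : ι) : MeasurePreserving (Function.eval i) (gP ι) (gaussianReal 0 1) :=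
  measurePreserving_eval_infinitePi _ i

lemma gP_memLp (i : ι) : MemLp (fun ω : ι → ℝ => ω i) 2 (gP ι) :=
  (memLp_id_gaussianReal' (μ := 0) (v := 1) 2 (by norm_num)).comp_measurePreserving (gP_eval i)

lemma gP_indep : iIndepFun (fun (i : ι) (ω : ι → ℝ) => ω i) (gP ι) :=
  iIndepFun_infinitePi (X := fun _ x => x) (fun _ => measurable_id)

/-- Coordinates as elements of `L²`. -/
noncomputable def gX (i : ι) : Lp ℝ 2 (gP ι) := (gP_memLp i).toLp _

lemma gX_coe (i : ι) : ∀ᵐ ω ∂(gP ι), gX i ω = ω i := MemLp.coeFn_toLp _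

lemma gX_int (i : ι) : ∫ ω, ω i ∂(gP ι) = 0 := by
  have h := integral_id_gaussianReal (μ := 0) (v := 1)
  rw [← (gP_eval i).map_eq, integral_map (gP_eval i).measurable.aemeasurable (by fun_prop)] at h
  exact h

lemma gX_orth : Orthonormal ℝ (gX (ι := ι)) := by
  classical
  rw [orthonormal_iff_ite]
  intro i j
  rw [L2.inner_def]
  have e : ∫ ω, inner ℝ (gX i ω) (gX j ω) ∂(gP ι) = ∫ ω, ω j * ω i ∂(gP ι) := by
    refine integral_congr_ae ?_
    filter_upwards [gX_coe i, gX_coe j] with ω h1 h2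
    rw [h1, h2]; rfl
  rw [e]
  split_ifs with hij
  · subst hij
    have h1 : ∫ ω, ω i * ω i ∂(gP ι) = ∫ x, x * x ∂(gaussianReal 0 1) := by
      rw [← (gP_eval i).map_eq, integral_map (gP_eval i).measurable.aemeasurable (by fun_prop)]
    rw [h1]
    have h2 := variance_id_gaussianReal (μ := 0) (v := 1)
    rw [variance_eq_integral (by fun_prop)] at h2
    simpa [pow_two] using h2
  · rw [IndepFun.integral_fun_mul_eq_mul_integral (gP_indep.indepFun (Ne.symm hij))
      (measurable_pi_apply j).aestronglyMeasurable (measurable_pi_apply i).aestronglyMeasurable, gX_int, zero_mul]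

variable {H : Type*} [NormedAddCommGroup H] [InnerProductSpace ℝ H] 

/-- The Gaussian isometry. -/
noncomputable def gW (b : HilbertBasis ι ℝ H) : H →ₗᵢ[ℝ] Lp ℝ 2 (gP ι) :=
  (gX_orth.orthogonalFamily.linearIsometry).comp b.repr.toLinearIsometry

lemma gW_basis (b : HilbertBasis ι ℝ H) (i : ι) : gW b (b i) = gX i := by
  classical
  have := gX_orth.orthogonalFamily.linearIsometry_apply_single (i := i) (1 : ℝ)
  change gX_orth.orthogonalFamily.linearIsometry (b.repr (b i)) = gX i
  rw [HilbertBasis.repr_self]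
  refine this.trans ?_
  simp

lemma gW_char (b : HilbertBasis ι ℝ H) (v : H) :
    chE (gP ι) (gW b v) = Complex.exp (-(‖v‖ ^ 2 / 2 : ℝ)) := by
  revert v
  rw [← funext_iff]
  have hd : Dense (Submodule.span ℝ (Set.range b) : Set H) := by
    rw [Submodule.dense_iff_topologicalClosure_eq_top]; exact b.dense_span
  refine Continuous.ext_on hd (chE_continuous.comp (gW b).continuous) (by fun_prop) ?_
  intro v hv
  obtain ⟨c, rfl⟩ := Finsupp.mem_span_range_iff_exists_finsupp.1 hv
  have hn : ‖c.sum fun i a => a • b i‖ ^ 2 = ∑ i ∈ c.support, c i ^ 2 := by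
    rw [← real_inner_self_eq_norm_sq, Finsupp.sum, b.orthonormal.inner_sum]
    simp [pow_two]
  change chE (gP ι) (gW b _) = _
  simp only [hn]
  have h1 : (gW b (c.sum fun i a => a • b i) : (ι → ℝ) → ℝ) =ᵐ[gP ι]
      fun ω => ∑ i ∈ c.support, c i * ω i := by
    rw [Finsupp.sum, map_sum]
    have h2 : ∀ᵐ ω ∂(gP ι), ∀ i ∈ c.support, gW b (c i • b i) ω = c i * ω i := by
      rw [Finset.eventually_all]
      intro i hi
      rw [map_smul, gW_basis]
      filter_upwards [Lp.coeFn_smul (c i) (gX i), gX_coe i] with ω h1 h2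
      rw [h1, Pi.smul_apply, h2, smul_eq_mul]
    filter_upwards [Lp_coeFn_sum c.support (fun i => gW b (c i • b i)), h2] with ω h3 h4
    rw [h3]
    exact Finset.sum_congr rfl h4
  rw [chE_congr h1]
  unfold chE
  have h3 : ∀ ω : ι → ℝ, Complex.exp (((∑ i ∈ c.support, c i * ω i : ℝ) : ℂ) * Complex.I)
      = ∏ i : c.support, (fun x : ℝ => Complex.exp (c i * x * Complex.I)) (ω i) := by
    intro ω
    rw [Finset.prod_coe_sort c.support (fun i => Complex.exp (c i * ω i * Complex.I)),
      ← Complex.exp_sum]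
    push_cast
    rw [Finset.sum_mul]
  simp only [h3]
  have h4 := (gP_indep (ι := ι)).precomp (g := ((↑) : c.support → ι)) Subtype.val_injective
  rw [iIndepFun.integral_fun_prod_comp (f := fun (i : c.support) (x : ℝ) => Complex.exp (c i * x * Complex.I))
    (X := fun (i : c.support) (ω : ι → ℝ) => ω i) h4 (fun i => (measurable_pi_apply _).aemeasurable)
    (by fun_prop)]
  have h5 : ∀ i : ι, ∫ ω : ι → ℝ, Complex.exp (c i * ω i * Complex.I) ∂(gP ι)
      = Complex.exp (-(c i ^ 2 / 2 : ℝ)) := by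
    intro i
    have := charFun_gaussianReal (μ := 0) (v := 1) (c i)
    rw [← (gP_eval i).map_eq, charFun_apply_real,
      integral_map (gP_eval i).measurable.aemeasurable (by fun_prop)] at this
    refine Eq.trans this ?_
    simp
  simp only [h5]
  rw [Finset.prod_coe_sort c.support (fun i => Complex.exp (-(c i ^ 2 / 2 : ℝ))), ← Complex.exp_sum]
  push_cast
  rw [Finset.sum_neg_distrib, Finset.sum_div]

lemma gW_law (b : HilbertBasis ι ℝ H) (v : H) :
    (gP ι).map (gW b v) = (gaussianReal 0 1).map (fun x => ‖v‖ * x) := by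
  have hm := (Lp.stronglyMeasurable (gW b v)).measurable
  have := Measure.isProbabilityMeasure_map (μ := gP ι) hm.aemeasurable
  have := Measure.isProbabilityMeasure_map (μ := gaussianReal 0 1)
    (f := fun x => ‖v‖ * x) (by fun_prop)
  refine Measure.ext_of_charFun ?_
  funext t
  rw [charFun_apply_real, charFun_apply_real, integral_map hm.aemeasurable (by fun_prop),
    integral_map (by fun_prop) (by fun_prop)]
  have h1 := gW_char b (t • v)
  have h2 := charFun_gaussianReal (μ := 0) (v := 1) (t * ‖v‖)
  rw [charFun_apply_real] at h2
  have e1 : ∫ ω, Complex.exp (t * (gW b v ω : ℝ) * Complex.I) ∂(gP ι) = chE (gP ι) (gW b (t • v)) := by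
    have : (gW b (t • v) : (ι → ℝ) → ℝ) =ᵐ[gP ι] fun ω => t * gW b v ω := by
      rw [map_smul]
      filter_upwards [Lp.coeFn_smul t (gW b v)] with ω h
      rw [h]; rfl
    rw [chE_congr this]
    unfold chE
    simp
  rw [e1, h1]
  have e2 : ∫ x : ℝ, Complex.exp (t * (‖v‖ * x : ℝ) * Complex.I) ∂(gaussianReal 0 1)
      = Complex.exp (-(‖t • v‖ ^ 2 / 2 : ℝ)) := by
    rw [norm_smul, mul_pow, Real.norm_eq_abs, sq_abs]
    convert h2 using 2
    · funext x; push_cast; congr 1; ring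
    · push_cast; simp; ring
  rw [e2]

end gauss


section gauss2
open Filter Topology ProbabilityTheory

variable {ι : Type*} {H : Type*} [NormedAddCommGroup H] [InnerProductSpace ℝ H] {q : ℝ}

lemma gW_meas (b : HilbertBasis ι ℝ H) (v : H) : Measurable (gW b v) :=
  (Lp.stronglyMeasurable (gW b v)).measurable

/-- Absolute moment of the standard Gaussian. -/
noncomputable def gC (q : ℝ) : ℝ≥0∞ := pInt (gaussianReal 0 1) q (id : ℝ → ℝ)

lemma gC_lt_top (hq : 0 < q) : gC q < ⊤ :=
  (memLp_iff_pInt hq (by fun_prop)).1 (memLp_id_gaussianReal' _ (by simp))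

lemma gC_ne_zero (hq : 0 < q) : gC q ≠ 0 := by
  intro h
  unfold gC pInt at h
  rw [lintegral_eq_zero_iff (by fun_prop)] at h
  have := nullSingletonClass_gaussianReal (μ := 0) (v := 1) one_ne_zero
  have h0 : ∀ᵐ x ∂(gaussianReal 0 1), x ≠ 0 := by
    rw [ae_iff]; simp
  have : ∀ᵐ x ∂(gaussianReal 0 1), False := by
    filter_upwards [h, h0] with x h1 h2
    simp [ENNReal.rpow_eq_zero_iff, h2] at h1
  simp at this
  exact IsProbabilityMeasure.ne_zero _ this

lemma pInt_gW (hq : 0 < q) (b : HilbertBasis ι ℝ H) (v : H) :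
    pInt (gP ι) q (gW b v) = ‖v‖ₑ ^ q * gC q := by
  have h1 : pInt (gP ι) q (gW b v) = ∫⁻ x, ‖x‖ₑ ^ q ∂((gP ι).map (gW b v)) := by
    rw [lintegral_map (by fun_prop) (gW_meas b v)]; rfl
  rw [h1, gW_law, lintegral_map (by fun_prop) (by fun_prop)]
  have := pInt_smul (ν := gaussianReal 0 1) hq ‖v‖ (id : ℝ → ℝ)
  rw [enorm_norm] at this
  exact this

lemma gW_preserving (b : HilbertBasis ι ℝ H) {u : ι → H} (hu : Orthonormal ℝ u) :
    MeasurePreserving (fun ω i => gW b (u i) ω) (gP ι) (gP ι) := by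
  have hm : ∀ i, Measurable (gW b (u i)) := fun i => gW_meas b (u i)
  refine ⟨measurable_pi_iff.2 hm, ?_⟩
  have hlaw : ∀ i, (gP ι).map (gW b (u i)) = gaussianReal 0 1 := fun i => by
    rw [gW_law, hu.1 i]; simp
  have hind : iIndepFun (fun i => (gW b (u i) : (ι → ℝ) → ℝ)) (gP ι) := by
    rw [iIndepFun_iff_finset]
    intro s
    refine (iIndepFun_iff_charFun_pi (X := fun (i : s) => (gW b (u i) : (ι → ℝ) → ℝ))
      (fun i => (hm i).aemeasurable)).2 ?_
    intro t
    simp only [hlaw, charFun_gaussianReal]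
    rw [charFun_apply, integral_map (by
      have : Measurable fun ω : ι → ℝ => fun i : s => gW b (u i) ω := measurable_pi_iff.2 fun i => hm i
      exact ((WithLp.measurable_toLp 2 _).comp this).aemeasurable) (by fun_prop)]
    have e : (gW b (∑ i : s, t i • u i) : (ι → ℝ) → ℝ) =ᵐ[gP ι]
        fun ω => inner ℝ (WithLp.toLp 2 (fun i : s => (gW b (u i) : (ι → ℝ) → ℝ) ω)) t := by
      rw [map_sum]
      have h2 : ∀ᵐ ω ∂(gP ι), ∀ i : s, gW b (t i • u i) ω = t i * gW b (u i) ω := by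
        rw [ae_all_iff]
        intro i
        rw [map_smul]
        filter_upwards [Lp.coeFn_smul (t i) (gW b (u i))] with ω h
        rw [h]; rfl
      filter_upwards [Lp_coeFn_sum Finset.univ (fun i : s => gW b (t i • u i)), h2] with ω h3 h4
      rw [h3]
      rw [PiLp.inner_apply]
      refine Finset.sum_congr rfl fun i _ => ?_
      rw [h4]; rfl
    have := gW_char b (∑ i : s, t i • u i)
    rw [chE_congr e] at this
    refine Eq.trans this ?_
    have hn : ‖∑ i : s, t i • u i‖ ^ 2 = ∑ i : s, t i ^ 2 := by
      rw [← real_inner_self_eq_norm_sq]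
      refine ((hu.comp ((↑) : s → ι) Subtype.val_injective).inner_sum (fun i => t i) (fun i => t i)
        Finset.univ).trans ?_
      simp [pow_two]
    rw [hn, ← Complex.exp_sum]
    simp
    rw [Finset.sum_div]
  have := (iIndepFun_iff_map_fun_eq_infinitePi_map hm).1 hind
  rw [this]
  simp only [hlaw]
  rfl

/-- A proper affine isometric action on a real Hilbert space. -/
structure HAct (G : Type*) [Group G] [TopologicalSpace G] (H : Type*) [NormedAddCommGroup H]
    [InnerProductSpace ℝ H] where
  U : G → H →ₗᵢ[ℝ] H
  c : G → H
  U_one : ∀ v, U 1 v = v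
  U_mul : ∀ g h v, U (g * h) v = U g (U h v)
  c_mul : ∀ g h, c (g * h) = c g + U g (c h)
  U_cont : ∀ v, Tendsto (fun g => ‖U g v - v‖ₑ) (𝓝 1) (𝓝 0)
  c_cont : Tendsto (fun g => ‖c g‖ₑ) (𝓝 1) (𝓝 0)
  proper : ∀ R : ℝ≥0∞, R ≠ ⊤ → IsCompact (closure {g | ‖c g‖ₑ ≤ R})

variable {G : Type*} [Group G] [TopologicalSpace G]

lemma gS_mp (b : HilbertBasis ι ℝ H) (U : H →ₗᵢ[ℝ] H) :
    MeasurePreserving (fun ω i => gW b (U (b i)) ω) (gP ι) (gP ι) :=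
  gW_preserving b (b.orthonormal.comp_linearIsometry U)

lemma gW_comp (b : HilbertBasis ι ℝ H) (U : H →ₗᵢ[ℝ] H) (v : H) :
    ∀ᵐ ω ∂(gP ι), gW b v (fun i => gW b (U (b i)) ω) = gW b (U v) ω := by
  have hd : Dense (Submodule.span ℝ (Set.range b) : Set H) := by
    rw [Submodule.dense_iff_topologicalClosure_eq_top]; exact b.dense_span
  have key : ((Lp.compMeasurePreservingₗᵢ ℝ _ (gS_mp b U)).comp (gW b)).toContinuousLinearMap
      = ((gW b).comp U).toContinuousLinearMap := by
    refine ContinuousLinearMap.ext_on hd ?_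
    rintro _ ⟨i, rfl⟩
    change Lp.compMeasurePreserving _ (gS_mp b U) (gW b (b i)) = gW b (U (b i))
    apply Lp.ext
    refine (Lp.coeFn_compMeasurePreserving _ _).trans ?_
    rw [gW_basis]
    filter_upwards [(gS_mp b U).quasiMeasurePreserving.ae (gX_coe i)] with ω h
    exact h
  have h1 := congrArg (fun T => T v) key
  have h2 : Lp.compMeasurePreserving _ (gS_mp b U) (gW b v) = gW b (U v) := h1
  have h3 := Lp.coeFn_compMeasurePreserving (gW b v) (gS_mp b U)
  rw [h2] at h3
  filter_upwards [h3] with ω h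
  exact h.symm

lemma gW_add (b : HilbertBasis ι ℝ H) (v w : H) :
    ∀ᵐ ω ∂(gP ι), gW b (v + w) ω = gW b v ω + gW b w ω := by
  rw [map_add]; exact Lp.coeFn_add _ _

lemma gW_sub (b : HilbertBasis ι ℝ H) (v w : H) :
    ∀ᵐ ω ∂(gP ι), gW b (v - w) ω = gW b v ω - gW b w ω := by
  rw [map_sub]; exact Lp.coeFn_sub _ _

lemma gW_tendsto (hq : 0 < q) (b : HilbertBasis ι ℝ H) {l : Filter G} {v : G → H}
    (h : Tendsto (fun g => ‖v g‖ₑ) l (𝓝 0)) :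
    Tendsto (fun g => pInt (gP ι) q (gW b (v g))) l (𝓝 0) := by
  simp only [pInt_gW hq]
  have h1 : Tendsto (fun g => ‖v g‖ₑ ^ q) l (𝓝 0) := by
    have := (ENNReal.continuous_rpow_const (y := q)).tendsto 0
    rw [ENNReal.zero_rpow_of_pos hq] at this
    exact this.comp h
  have := ENNReal.Tendsto.mul_const (b := gC q) h1 (Or.inr (gC_lt_top hq).ne)
  simpa using this

/-- The Gaussian nonsingular (in fact measure preserving) data. -/
noncomputable def gData [Countable ι] (b : HilbertBasis ι ℝ H) (A : HAct G H) (hq : 0 < q) :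
    NSData G (gP ι) q where
  S g ω i := gW b (A.U g (b i)) ω
  w _ _ := 1
  b g := gW b (A.c g)
  hS g := (gS_mp b (A.U g)).measurable
  hw _ := measurable_const
  hb g := gW_meas b _
  hw0 _ _ := one_pos
  hmap g F hF := by
    simp only [enorm_one, ENNReal.one_rpow, one_mul]
    exact (gS_mp b (A.U g)).lintegral_comp hF
  hone := by
    have : ∀ᵐ ω ∂(gP ι), ∀ i, gX i ω = ω i := ae_all_iff.2 gX_coe
    filter_upwards [this] with ω h
    refine ⟨?_, rfl⟩
    funext i
    rw [A.U_one, gW_basis, h]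
  hmul g h := by
    have : ∀ᵐ ω ∂(gP ι), ∀ i, gW b (A.U h (b i)) (fun i => gW b (A.U g (b i)) ω)
      = gW b (A.U g (A.U h (b i))) ω := ae_all_iff.2 fun i => gW_comp b (A.U g) _
    filter_upwards [this] with ω h1
    refine ⟨?_, by simp⟩
    funext i
    rw [A.U_mul, h1]
  hbfin g := by
    rw [pInt_gW hq]
    exact ENNReal.mul_lt_top (ENNReal.rpow_lt_top_of_nonneg hq.le enorm_ne_top) (gC_lt_top hq)
  hbmul g h := by
    rw [A.c_mul]
    filter_upwards [gW_add b (A.c g) (A.U g (A.c h)), gW_comp b (A.U g) (A.c h)] with ω h1 h2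
    rw [h1, one_mul, h2]
  hbc := gW_tendsto hq b A.c_cont

lemma gData_cont [Countable ι] (b : HilbertBasis ι ℝ H) (A : HAct G H) (hq : 0 < q)
    (F : (ι → ℝ) → ℝ) (hF : AEMeasurable F (gP ι)) (hFfin : pInt (gP ι) q F < ⊤) :
    (gData b A hq).Cont F := by
  have hc : ∀ t : ℝ, (gData b A hq).Cont (fun _ => t) := fun t => by
    refine ⟨aemeasurable_const, ?_, ?_⟩
    · have := ENNReal.rpow_lt_top_of_nonneg hq.le (enorm_ne_top (x := t))
      simpa [pInt] using this
    · simp [pInt, gData, hq]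
  have hW : ∀ i : ι, (gData b A hq).Cont (fun ω => ω i) := fun i => by
    refine NSData.Cont.congr hq (F := (gW b (b i) : (ι → ℝ) → ℝ)) ?_
      (by rw [gW_basis]; exact gX_coe i)
    refine ⟨(gW_meas b _).aemeasurable, ?_, ?_⟩
    · rw [pInt_gW hq]
      exact ENNReal.mul_lt_top (ENNReal.rpow_lt_top_of_nonneg hq.le enorm_ne_top) (gC_lt_top hq)
    · refine (gW_tendsto hq b (A.U_cont (b i))).congr fun g => pInt_congr ?_
      filter_upwards [gW_comp b (A.U g) (b i), gW_sub b (A.U g (b i)) (b i)] with ω h1 h2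
      rw [h2, ← h1]
      simp [gData]
  have hp : ∀ᵐ ω ∂(gP ι), (0 : ℝ) < (fun _ => (1 : ℝ)) ω := ae_of_all _ fun _ => one_pos
  have hp' : ∀ᵐ ω ∂(gP ι), (0 : ℝ) ≤ (fun _ => (1 : ℝ)) ω := ae_of_all _ fun _ => zero_le_one
  refine NSData.cont_of_sigE hq (hc 1) hp hp' ?_ hF hFfin
  refine iSup_le fun i => ?_
  refine Measurable.comap_le (measurable_of_Ioi fun t => ?_)
  have := (hc 1).indicator_pos hq hp' ((hW i).sub hq (hc t))
  have e : (fun ω : ι → ℝ => ω i) ⁻¹' Set.Ioi t = {ω | 0 < ω i - t} := by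
    ext ω; simp
  change (gData b A hq).Cont (((fun ω : ι → ℝ => ω i) ⁻¹' Set.Ioi t).indicator _)
  rw [e]
  exact this

lemma hilbert_countable [TopologicalSpace.SeparableSpace H] (b : HilbertBasis ι ℝ H) : Countable ι := by
  rw [← Set.countable_univ_iff]
  refine Set.PairwiseDisjoint.countable_of_isOpen (s := fun i => Metric.ball (b i) (1 / 2)) ?_
    (fun i _ => Metric.isOpen_ball) (fun i _ => ⟨b i, by simp⟩)
  intro i _ j _ hij
  refine Metric.ball_disjoint_ball ?_
  have h1 : ‖b i - b j‖ ^ 2 = 2 := by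
    rw [norm_sub_sq_real, b.orthonormal.1 i, b.orthonormal.1 j, b.orthonormal.2 hij]; norm_num
  rw [dist_eq_norm]
  nlinarith [norm_nonneg (b i - b j)]

theorem gauss_case {H : Type} [NormedAddCommGroup H] [InnerProductSpace ℝ H] [CompleteSpace H]
    [TopologicalSpace.SeparableSpace H] [IsTopologicalGroup G] (hq : 0 < q) (A : HAct G H) :
    ∃ (Y : Type) (_ : MeasurableSpace Y) (ν : Measure Y),
      StandardBorelSpace Y ∧ SigmaFinite ν ∧
      ∃ β : AffineIsometricAction G ν q, β.MetricallyProper := by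
  obtain ⟨w, b, -⟩ := exists_hilbertBasis ℝ H
  have : Countable w := hilbert_countable b
  refine ⟨w → ℝ, inferInstance, gP w, inferInstance, inferInstance, ?_⟩
  refine NSData.exists_action (gData b A hq) hq (gData_cont b A hq) fun R hR => ?_
  have hk := gC_ne_zero hq
  have := A.proper ((R / gC q) ^ (1 / q))
    (ENNReal.rpow_ne_top_of_nonneg (by positivity) (ENNReal.div_ne_top hR hk))
  convert this using 3
  ext g
  have e : pInt (gP w) q ((gData b A hq).b g) = ‖A.c g‖ₑ ^ q * gC q := pInt_gW hq b _
  rw [e, ← ENNReal.le_div_iff_mul_le (Or.inl hk) (Or.inl (gC_lt_top hq).ne),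
    one_div, ENNReal.le_rpow_inv_iff hq]

end gauss2


section hact
open Filter Topology

variable {X : Type*} [MeasurableSpace X] {μ : Measure X} 

lemma InL.memLp2 {F : X → ℂ} (hF : InL μ 2 F) : MemLp F 2 μ := by
  have := hF.memLp two_pos
  simpa using this

lemma Lp2_InL (f : Lp ℂ 2 μ) : InL μ 2 f := by
  refine ⟨(Lp.stronglyMeasurable f).measurable, (memLp_iff_pInt two_pos (Lp.memLp f).1).1 ?_⟩
  simpa using Lp.memLp f

lemma Lp2_enorm (f : Lp ℂ 2 μ) : ‖f‖ₑ ^ (2 : ℝ) = pInt μ 2 f := by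
  rw [Lp.enorm_def, eLpNorm_eq_lintegral_rpow_enorm_toReal two_ne_zero ofNat_ne_top, ← ENNReal.rpow_mul]
  simp [pInt]

lemma Lp2_enorm' (f : Lp ℂ 2 μ) : ‖f‖ₑ = (pInt μ 2 f) ^ (1 / 2 : ℝ) := by
  rw [← Lp2_enorm, ← ENNReal.rpow_mul]
  norm_num

variable {G : Type*} [Group G] [TopologicalSpace G]

/-- The linear part on `L²`. -/
noncomputable def hU (A : FnAct G μ 2) (g : G) (f : Lp ℂ 2 μ) : Lp ℂ 2 μ :=
  (((A.U_isoOp two_pos g).mem f (Lp2_InL f)).memLp2).toLp _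

lemma hU_coe (A : FnAct G μ 2) (g : G) (f : Lp ℂ 2 μ) : hU A g f =ᵐ[μ] A.U g f :=
  MemLp.coeFn_toLp _

/-- The translation part on `L²`. -/
noncomputable def hc (A : FnAct G μ 2) (g : G) : Lp ℂ 2 μ := ((A.c_mem two_pos g).memLp2).toLp _

lemma hc_coe (A : FnAct G μ 2) (g : G) : hc A g =ᵐ[μ] A.c g := MemLp.coeFn_toLp _

lemma hU_add (A : FnAct G μ 2) (g : G) (f f' : Lp ℂ 2 μ) :
    hU A g (f + f') = hU A g f + hU A g f' := by
  have hT := A.U_isoOp two_pos g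
  apply Lp.ext
  filter_upwards [hU_coe A g (f + f'), hU_coe A g f, hU_coe A g f',
    Lp.coeFn_add (hU A g f) (hU A g f'), hT.add f f' (Lp2_InL f) (Lp2_InL f'),
    hT.congr _ _ (Lp2_InL (f + f')) ((Lp2_InL f).add two_pos (Lp2_InL f')) (Lp.coeFn_add f f')]
    with x h1 h2 h3 h4 h5 h6
  rw [h1, h4, Pi.add_apply, h2, h3, h6, h5]

lemma hU_smul (A : FnAct G μ 2) (g : G) (t : ℝ) (f : Lp ℂ 2 μ) :
    hU A g ((t : ℂ) • f) = (t : ℂ) • hU A g f := by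
  have hT := A.U_isoOp two_pos g
  have e : ((t : ℂ) • f : Lp ℂ 2 μ) =ᵐ[μ] fun x => t • f x := by
    filter_upwards [Lp.coeFn_smul (t : ℂ) f] with x h
    rw [h]; simp
  apply Lp.ext
  filter_upwards [hU_coe A g ((t : ℂ) • f), hU_coe A g f,
    Lp.coeFn_smul (t : ℂ) (hU A g f), hT.smul t f (Lp2_InL f),
    hT.congr _ _ (Lp2_InL ((t : ℂ) • f)) ((Lp2_InL f).smul two_pos t) e]
    with x h1 h2 h4 h5 h6
  rw [h1, h4, Pi.smul_apply, h2, h6, h5]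
  simp

lemma hU_norm (A : FnAct G μ 2) (g : G) (f : Lp ℂ 2 μ) : ‖hU A g f‖ = ‖f‖ := by
  have : ‖hU A g f‖ₑ = ‖f‖ₑ := by
    rw [Lp2_enorm', Lp2_enorm', ← (A.U_isoOp two_pos g).iso f (Lp2_InL f)]
    congr 1
    refine pInt_congr ?_
    filter_upwards [hU_coe A g f] with x h
    rw [h]
  rw [← toReal_enorm, ← toReal_enorm, this]

lemma hc_mul (A : FnAct G μ 2) (g h : G) : hc A (g * h) = hc A g + hU A g (hc A h) := by
  apply Lp.ext
  filter_upwards [hc_coe A (g * h), Lp.coeFn_add (hc A g) (hU A g (hc A h)), hc_coe A g,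
    hU_coe A g (hc A h), A.mul g h _ (InL.zero two_pos),
    A.congr g _ _ (Lp2_InL (hc A h)) (A.c_mem two_pos h) (hc_coe A h)] with x h1 h2 h3 h4 h5 h6
  rw [h1, h2, Pi.add_apply, h3, h4, FnAct.U, h6, FnAct.c, h5]
  simp [FnAct.c]

lemma hU_one (A : FnAct G μ 2) (f : Lp ℂ 2 μ) : hU A 1 f = f := by
  apply Lp.ext
  filter_upwards [hU_coe A 1 f, A.one f (Lp2_InL f), A.one _ (InL.zero two_pos)] with x h1 h2 h3
  rw [h1, FnAct.U, h2, FnAct.c, h3, sub_zero]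

lemma hA_coe (A : FnAct G μ 2) (g : G) (f : Lp ℂ 2 μ) :
    (hc A g + hU A g f : Lp ℂ 2 μ) =ᵐ[μ] A.fn g f := by
  filter_upwards [Lp.coeFn_add (hc A g) (hU A g f), hc_coe A g, hU_coe A g f] with x h1 h2 h3
  rw [h1, Pi.add_apply, h2, h3, FnAct.U]; simp

lemma hA_mul (A : FnAct G μ 2) (g h : G) (f : Lp ℂ 2 μ) :
    hc A (g * h) + hU A (g * h) f = hc A g + hU A g (hc A h + hU A h f) := by
  apply Lp.ext
  filter_upwards [hA_coe A (g * h) f, hA_coe A g (hc A h + hU A h f), A.mul g h f (Lp2_InL f),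
    A.congr g _ _ (Lp2_InL (hc A h + hU A h f)) (A.mem h f (Lp2_InL f)) (hA_coe A h f)]
    with x h1 h2 h3 h4
  rw [h1, h2, h3, h4]

lemma hU_mul (A : FnAct G μ 2) (g h : G) (f : Lp ℂ 2 μ) :
    hU A (g * h) f = hU A g (hU A h f) := by
  have := hA_mul A g h f
  rw [hc_mul, hU_add, ← add_assoc] at this
  exact add_left_cancel this

lemma half_tendsto {κ : Type*} {l : Filter κ} {f : κ → ℝ≥0∞} (h : Tendsto f l (𝓝 0)) :
    Tendsto (fun g => f g ^ (1 / 2 : ℝ)) l (𝓝 0) := by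
  have := (ENNReal.continuous_rpow_const (y := (1 / 2 : ℝ))).tendsto 0
  rw [ENNReal.zero_rpow_of_pos (by norm_num)] at this
  exact this.comp h

lemma hc_enorm (A : FnAct G μ 2) (g : G) : ‖hc A g‖ₑ = (pInt μ 2 (A.c g)) ^ (1 / 2 : ℝ) := by
  rw [Lp2_enorm']
  congr 1
  refine pInt_congr ?_
  filter_upwards [hc_coe A g] with x h
  rw [h]

lemma hc_cont (A : FnAct G μ 2) : Tendsto (fun g => ‖hc A g‖ₑ) (𝓝 1) (𝓝 0) := by
  simp only [hc_enorm]
  have := A.cont _ (InL.zero two_pos)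
  simp only [sub_zero] at this
  exact half_tendsto this

lemma hU_cont (A : FnAct G μ 2) (f : Lp ℂ 2 μ) :
    Tendsto (fun g => ‖hU A g f - f‖ₑ) (𝓝 1) (𝓝 0) := by
  have h1 : Tendsto (fun g => ‖hc A g + hU A g f - f‖ₑ) (𝓝 1) (𝓝 0) := by
    refine (half_tendsto (A.cont f (Lp2_InL f))).congr fun g => ?_
    rw [Lp2_enorm']
    congr 1
    refine pInt_congr ?_
    filter_upwards [Lp.coeFn_sub (hc A g + hU A g f) f, hA_coe A g f] with x h1 h2
    rw [h1, Pi.sub_apply, h2]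
  have h2 := h1.add (hc_cont A)
  rw [add_zero] at h2
  refine tendsto_of_tendsto_of_tendsto_of_le_of_le tendsto_const_nhds h2 (fun _ => zero_le) fun g => ?_
  have : hU A g f - f = (hc A g + hU A g f - f) - hc A g := by abel
  change ‖hU A g f - f‖ₑ ≤ _
  rw [this]
  exact enorm_sub_le

theorem gauss_case2 {X : Type} [MeasurableSpace X] {μ : Measure X} [SigmaFinite μ]
    [StandardBorelSpace X] [IsTopologicalGroup G] {q : ℝ} (hq : 0 < q) (A : FnAct G μ 2) :
    ∃ (Y : Type) (_ : MeasurableSpace Y) (ν : Measure Y),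
      StandardBorelSpace Y ∧ SigmaFinite ν ∧
      ∃ β : AffineIsometricAction G ν q, β.MetricallyProper := by
  letI : InnerProductSpace ℝ (Lp ℂ 2 μ) := InnerProductSpace.rclikeToReal ℂ (Lp ℂ 2 μ)
  haveI : Fact ((2 : ℝ≥0∞) ≠ ⊤) := ⟨ofNat_ne_top⟩
  haveI : SecondCountableTopology (Lp ℂ 2 μ) := inferInstance
  refine gauss_case (H := Lp ℂ 2 μ) hq
    { U := fun g =>
        { toFun := hU A g
          map_add' := hU_add A g
          map_smul' := fun t f => hU_smul A g t f
          norm_map' := hU_norm A g }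
      c := hc A
      U_one := hU_one A
      U_mul := hU_mul A
      c_mul := hc_mul A
      U_cont := hU_cont A
      c_cont := hc_cont A
      proper := fun R hR => ?_ }
  have := A.proper (R ^ (2 : ℝ)) (ENNReal.rpow_ne_top_of_nonneg (by norm_num) hR)
  convert this using 3
  ext g
  rw [hc_enorm, one_div, ENNReal.rpow_inv_le_iff two_pos]
  rfl

end hact

theorem final {G : Type*} [Group G] [TopologicalSpace G] [IsTopologicalGroup G]
    [LocallyCompactSpace G]
    {p q : ℝ} (hp : 0 < p) (hpq : p < q)
    (h : ∃ (X : Type) (_ : MeasurableSpace X) (μ : Measure X),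
      StandardBorelSpace X ∧ SigmaFinite μ ∧
      ∃ α : AffineIsometricAction G μ p, α.MetricallyProper) :
    ∃ (Y : Type) (_ : MeasurableSpace Y) (ν : Measure Y),
      StandardBorelSpace Y ∧ SigmaFinite ν ∧
      ∃ β : AffineIsometricAction G ν q, β.MetricallyProper := by
  obtain ⟨X, mX, μ, hX, hμ, α, hα⟩ := h
  have A := α.toFnAct hp hα
  by_cases hp2 : p = 2
  · subst hp2
    exact gauss_case2 (hp.trans hpq) A
  · exact ⟨X × ℂ, inferInstance, μ.prod volume, inferInstance, inferInstance,
      lamperti_case hp hp2 hpq A⟩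

/-- **Corollary (ii).** For a locally compact topological group `G`, the set of
`p ∈ (0,∞)` such that `G` admits a metrically proper continuous affine isometric action
on an `L_p` space is upward closed: if `0 < p < q < ∞` and `G` admits such an action on
some `L_p` space, then it admits one on some `L_q` space. -/
theorem stmt2 {G : Type*} [Group G] [TopologicalSpace G] [IsTopologicalGroup G]
    [LocallyCompactSpace G]
    {p q : ℝ} (hp : 0 < p) (hpq : p < q)
    (h : ∃ (X : Type) (_ : MeasurableSpace X) (μ : Measure X),
      StandardBorelSpace X ∧ SigmaFinite μ ∧
      ∃ α : AffineIsometricAction G μ p, α.MetricallyProper) :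
    ∃ (Y : Type) (_ : MeasurableSpace Y) (ν : Measure Y),
      StandardBorelSpace Y ∧ SigmaFinite ν ∧
      ∃ β : AffineIsometricAction G ν q, β.MetricallyProper := by
  exact final hp hpq h
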